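/- arXiv:1805.00584 — 4 statements merged into one kernel-verified Lean document; each statement's English description precedes it below -/
import Mathlib

section
/- Let E be a complex normed vector space and let ψ : E → ℝ be twice (real) Fréchet differentiable at p ∈ E, with ψ(x) ≥ 0 for all x ∈ E. If the Levi form of ψ is positive semidefinite at p (i.e. L_ψ(p,v) ≥ 0 for all v ∈ E), then the Levi form of ψ² is positive semidefinite at p (i.e. L_{ψ²}(p,v) ≥ 0 for all v ∈ E). -/
open Complex Filter

/-- The Levi form (up to a positive constant) of a function `f : E → ℝ` at `p` in the
direction `v`: `L_f(p,v) = D²f(p)(v,v) + D²f(p)(i·v, i·v)`, where the second derivative is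
the second real Fréchet derivative `fderiv ℝ (fderiv ℝ f) p`. -/
noncomputable def leviForm {E : Type*} [NormedAddCommGroup E] [NormedSpace ℂ E]
    (f : E → ℝ) (p v : E) : ℝ :=
  fderiv ℝ (fderiv ℝ f) p v v + fderiv ℝ (fderiv ℝ f) p (Complex.I • v) (Complex.I • v)

/-- The second derivative of the square of a function that is twice differentiable at `p`. -/
theorem fderiv_fderiv_sq_apply {E : Type*} [NormedAddCommGroup E] [NormedSpace ℝ E]
    {f : E → ℝ} {p : E} (h1 : ∀ᶠ x in nhds p, DifferentiableAt ℝ f x)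
    (h2 : DifferentiableAt ℝ (fderiv ℝ f) p) (v w : E) :
    fderiv ℝ (fderiv ℝ fun x => f x ^ 2) p v w =
      2 * (f p * fderiv ℝ (fderiv ℝ f) p v w + fderiv ℝ f p v * fderiv ℝ f p w) := by
  have hev : (fderiv ℝ fun x => f x ^ 2) =ᶠ[nhds p] (fun x => 2 * f x) • fderiv ℝ f := by
    filter_upwards [h1] with x hx
    simpa using (hx.hasFDerivAt.pow 2).fderiv
  have hd := (h1.self_of_nhds.hasFDerivAt.const_mul 2).smul h2.hasFDerivAt
  rw [hev.fderiv_eq, hd.fderiv]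
  simp
  ring

/-- if `ψ ≥ 0` is twice real Fréchet differentiable at `p` and its Levi form
is positive semidefinite at `p`, then the Levi form of `ψ²` is positive semidefinite at `p`. -/
theorem leviForm_sq_nonneg {E : Type*} [NormedAddCommGroup E] [NormedSpace ℂ E]
    (ψ : E → ℝ) (p : E)
    (h1 : ∀ᶠ x in nhds p, DifferentiableAt ℝ ψ x)
    (h2 : DifferentiableAt ℝ (fderiv ℝ ψ) p)
    (hnonneg : ∀ x, 0 ≤ ψ x)
    (hpsh : ∀ v : E, 0 ≤ leviForm ψ p v) :
    ∀ v : E, 0 ≤ leviForm (fun x => ψ x ^ 2) p v := by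
  intro v
  have hv := mul_nonneg (hnonneg p) (hpsh v)
  simp only [leviForm, fderiv_fderiv_sq_apply h1 h2] at hv ⊢
  nlinarith [sq_nonneg (fderiv ℝ ψ p v), sq_nonneg (fderiv ℝ ψ p (Complex.I • v))]
end

section
/- Let E be a complex normed vector space and let φ, α : E → ℝ be twice (real) Fréchet differentiable at p ∈ E, with φ(x) ≥ 0 and α(x) ≥ 0 for all x ∈ E, φ(p) > 0 and α(p) > 0. Assume the Levi forms of φ and of α are positive semidefinite at p. If v ∈ E satisfies L_{φ² + α²}(p,v) = 0, then Dφ(p)(v) = 0, Dφ(p)(i·v) = 0, Dα(p)(v) = 0, Dα(p)(i·v) = 0, L_φ(p,v) = 0 and L_α(p,v) = 0. In particular, any direction in the kernel of the Levi form of φ² + α² at p lies simultaneously in the kernels of dφ(p), dα(p) and of the Levi forms of φ and α at p. -/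
open Complex Filter

section LeviForm

variable {E : Type*} [NormedAddCommGroup E] [NormedSpace ℂ E] {f g : E → ℝ} {p : E}

theorem hasFDerivAt_fderiv_sq (hf1 : ∀ᶠ x in nhds p, DifferentiableAt ℝ f x)
    (hf2 : DifferentiableAt ℝ (fderiv ℝ f) p) :
    HasFDerivAt (fderiv ℝ fun x => f x ^ 2)
      ((2 * f p) • fderiv ℝ (fderiv ℝ f) p +
        ((2 : ℝ) • fderiv ℝ f p).smulRight (fderiv ℝ f p)) p := by
  have h : (fderiv ℝ fun x => f x ^ 2) =ᶠ[nhds p] fun x => (2 * f x) • fderiv ℝ f x := by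
    filter_upwards [hf1] with x hx
    simpa using (hx.hasFDerivAt.pow 2).fderiv
  exact ((hf1.self_of_nhds.hasFDerivAt.const_mul 2).smul hf2.hasFDerivAt).congr_of_eventuallyEq h

theorem leviForm_sq (hf1 : ∀ᶠ x in nhds p, DifferentiableAt ℝ f x)
    (hf2 : DifferentiableAt ℝ (fderiv ℝ f) p) (v : E) :
    leviForm (fun x => f x ^ 2) p v =
      2 * f p * leviForm f p v +
        2 * (fderiv ℝ f p v ^ 2 + fderiv ℝ f p (Complex.I • v) ^ 2) := by
  simp only [leviForm, (hasFDerivAt_fderiv_sq hf1 hf2).fderiv, add_apply,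
    smul_apply, ContinuousLinearMap.smulRight_apply, smul_eq_mul]
  ring

theorem leviForm_add (hf1 : ∀ᶠ x in nhds p, DifferentiableAt ℝ f x)
    (hf2 : DifferentiableAt ℝ (fderiv ℝ f) p)
    (hg1 : ∀ᶠ x in nhds p, DifferentiableAt ℝ g x)
    (hg2 : DifferentiableAt ℝ (fderiv ℝ g) p) (v : E) :
    leviForm (fun x => f x + g x) p v = leviForm f p v + leviForm g p v := by
  have h : (fderiv ℝ fun x => f x + g x) =ᶠ[nhds p] fun x => fderiv ℝ f x + fderiv ℝ g x := by
    filter_upwards [hf1, hg1] with x hfx hgx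
    exact (hfx.hasFDerivAt.add hgx.hasFDerivAt).fderiv
  simp only [leviForm,
    ((hf2.hasFDerivAt.add hg2.hasFDerivAt).congr_of_eventuallyEq h).fderiv,
    add_apply]
  ring

end LeviForm

/-- for `φ, α ≥ 0` twice real Fréchet differentiable at `p`, positive at `p`,
with positive semidefinite Levi forms at `p`, any direction in the kernel of the Levi form
of `φ² + α²` at `p` lies in the kernels of `dφ(p)`, `dα(p)` and of the Levi forms of
`φ` and `α` at `p`. -/
theorem leviForm_sq_add_sq_degenerate {E : Type*} [NormedAddCommGroup E] [NormedSpace ℂ E]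
    (φ α : E → ℝ) (p : E)
    (hφ1 : ∀ᶠ x in nhds p, DifferentiableAt ℝ φ x)
    (hφ2 : DifferentiableAt ℝ (fderiv ℝ φ) p)
    (hα1 : ∀ᶠ x in nhds p, DifferentiableAt ℝ α x)
    (hα2 : DifferentiableAt ℝ (fderiv ℝ α) p)
    (hφnonneg : ∀ x, 0 ≤ φ x) (hαnonneg : ∀ x, 0 ≤ α x)
    (hφpos : 0 < φ p) (hαpos : 0 < α p)
    (hφpsh : ∀ v : E, 0 ≤ leviForm φ p v)
    (hαpsh : ∀ v : E, 0 ≤ leviForm α p v)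
    (v : E) (hv : leviForm (fun x => φ x ^ 2 + α x ^ 2) p v = 0) :
    fderiv ℝ φ p v = 0 ∧ fderiv ℝ φ p (Complex.I • v) = 0 ∧
    fderiv ℝ α p v = 0 ∧ fderiv ℝ α p (Complex.I • v) = 0 ∧
    leviForm φ p v = 0 ∧ leviForm α p v = 0 := by
  have hsum := leviForm_add (f := fun x => φ x ^ 2) (g := fun x => α x ^ 2)
    (hφ1.mono fun x hx => hx.pow 2)
    (hasFDerivAt_fderiv_sq hφ1 hφ2).differentiableAt (hα1.mono fun x hx => hx.pow 2)
    (hasFDerivAt_fderiv_sq hα1 hα2).differentiableAt v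
  rw [hv, leviForm_sq hφ1 hφ2, leviForm_sq hα1 hα2] at hsum
  have hφL := mul_nonneg hφpos.le (hφpsh v)
  have hαL := mul_nonneg hαpos.le (hαpsh v)
  have h1 := sq_nonneg (fderiv ℝ φ p v)
  have h2 := sq_nonneg (fderiv ℝ φ p (Complex.I • v))
  have h3 := sq_nonneg (fderiv ℝ α p v)
  have h4 := sq_nonneg (fderiv ℝ α p (Complex.I • v))
  refine ⟨sq_eq_zero_iff.mp ?_, sq_eq_zero_iff.mp ?_, sq_eq_zero_iff.mp ?_,
    sq_eq_zero_iff.mp ?_, (mul_eq_zero_iff_left hφpos.ne').mp ?_,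
    (mul_eq_zero_iff_left hαpos.ne').mp ?_⟩ <;> linarith
end

section
/- Let X and T be topological spaces, F : X → T a continuous open map, D ⊆ X an open set, and φ : D → ℝ a continuous function. Let Ω ⊆ T be a set such that for every t ∈ Ω one has F⁻¹({t}) ⊆ D and φ is constant on F⁻¹({t}). Then for every t in the closure of Ω, the function φ is constant on F⁻¹({t}) ∩ D. -/
/-- let `F : X → T` be continuous and open, `D ⊆ X` open, `φ` continuous on
`D`. If `Ω ⊆ T` is such that every fiber over `Ω` is contained in `D` and `φ` is constant
on it, then for every `t` in the closure of `Ω`, `φ` is constant on `F⁻¹({t}) ∩ D`. -/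
theorem const_on_fiber_of_mem_closure
    {X T : Type*} [TopologicalSpace X] [TopologicalSpace T]
    (F : X → T) (hFcont : Continuous F) (hFopen : IsOpenMap F)
    (D : Set X) (hD : IsOpen D)
    (φ : X → ℝ) (hφcont : ContinuousOn φ D)
    (Ω : Set T)
    (hΩ : ∀ t ∈ Ω, F ⁻¹' {t} ⊆ D ∧ ∀ x ∈ F ⁻¹' {t}, ∀ y ∈ F ⁻¹' {t}, φ x = φ y)
    (t : T) (ht : t ∈ closure Ω) :
    ∀ x ∈ F ⁻¹' {t} ∩ D, ∀ y ∈ F ⁻¹' {t} ∩ D, φ x = φ y := by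
  rintro x ⟨hxt, hxD⟩ y ⟨hyt, hyD⟩
  by_contra hne
  obtain ⟨A, B, hA, hB, hxA, hyB, hAB⟩ := t2_separation hne
  have hU : IsOpen (F '' (D ∩ φ ⁻¹' A)) := hFopen _ (hφcont.isOpen_inter_preimage hD hA)
  have hV : IsOpen (F '' (D ∩ φ ⁻¹' B)) := hFopen _ (hφcont.isOpen_inter_preimage hD hB)
  obtain ⟨s, ⟨⟨x', ⟨-, hx'A⟩, hx's⟩, ⟨y', ⟨-, hy'B⟩, hy's⟩⟩, hs⟩ :=
    mem_closure_iff.1 ht _ (hU.inter hV) ⟨⟨x, ⟨hxD, hxA⟩, hxt⟩, ⟨y, ⟨hyD, hyB⟩, hyt⟩⟩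
  have hφ : φ x' = φ y' := (hΩ s hs).2 x' hx's y' hy's
  exact Set.disjoint_left.1 hAB hx'A (hφ ▸ hy'B)
end

section
/- Let n ≥ 1 and let f : ℝⁿ → ℝ be a real-analytic function that is proper (the preimage of every compact subset of ℝ is compact). Then the set of critical values of f, i.e. { f(x) : x ∈ ℝⁿ, df(x) = 0 }, is a closed and discrete subset of ℝ; in particular, the critical values of f cannot accumulate at any real number. -/
open Topology Filter

/-- Every extension of fields of characteristic zero is formally smooth. -/
theorem formallySmooth_of_charZero (L K : Type*) [Field L] [Field K] [CharZero L] [Algebra L K] :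
    Algebra.FormallySmooth L K := by
  obtain ⟨s, hs⟩ := exists_isTranscendenceBasis L K
  have := hs.isAlgebraic_field
  exact Algebra.FormallySmooth.of_algebraicIndependent_of_isSeparable hs.1

theorem formallySmooth_of_injective (R K : Type*) [CommRing R] [IsDomain R] [Field K]
    [CharZero K] [Algebra R K] (hinj : Function.Injective (algebraMap R K)) :
    Algebra.FormallySmooth R K := by
  have : FaithfulSMul R K := (faithfulSMul_iff_algebraMap_injective R K).2 hinj
  let : Algebra (FractionRing R) K := FractionRing.liftAlgebra R K
  have : CharZero (FractionRing R) := (algebraMap (FractionRing R) K).charZero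
  have := formallySmooth_of_charZero (FractionRing R) K
  have : Algebra.FormallySmooth R (FractionRing R) := .of_isLocalization (nonZeroDivisors R)
  exact .comp R (FractionRing R) K

theorem exists_ringHom_lift {R K B : Type*} [CommRing R] [IsDomain R] [Field K] [CharZero K]
    [CommRing B] [Algebra R K] (hinj : Function.Injective (algebraMap R K)) (φ : R →+* B)
    (π : B →+* K) (hπ : Function.Surjective π) (hker : ∀ x y, π x = 0 → π y = 0 → x * y = 0)
    (hφ : π.comp φ = algebraMap R K) :
    ∃ ψ : K →+* B, (∀ r, ψ (algebraMap R K r) = φ r) ∧ ∀ k, π (ψ k) = k := by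
  have := formallySmooth_of_injective R K hinj
  let := φ.toAlgebra
  let π' : B →ₐ[R] K := { π with commutes' := fun r => RingHom.congr_fun hφ r }
  have hnil : IsNilpotent (RingHom.ker (π' : B →+* K)) := by
    refine ⟨2, ?_⟩
    rw [pow_two, Ideal.zero_eq_bot, eq_bot_iff, Ideal.mul_le]
    exact fun x hx y hy => (Ideal.mem_bot).2 (hker x y hx hy)
  let ψ := Algebra.FormallySmooth.liftOfSurjective (AlgHom.id R K) π' hπ hnil
  exact ⟨ψ, fun r => ψ.commutes r,
    fun k => Algebra.FormallySmooth.liftOfSurjective_apply (AlgHom.id R K) π' hπ hnil k⟩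

/-- In characteristic zero, derivations from a domain to an overfield extend to that field. -/
theorem exists_derivation_extension {R K : Type*} [CommRing R] [IsDomain R] [Field K] [CharZero K]
    [Algebra R K] (hinj : Function.Injective (algebraMap R K)) (D : R → K)
    (hadd : ∀ a b, D (a + b) = D a + D b)
    (hmul : ∀ a b, D (a * b) = algebraMap R K a * D b + algebraMap R K b * D a) :
    ∃ D' : Derivation ℤ K K, ∀ r, D' (algebraMap R K r) = D r := by
  have h1 : D 1 = 0 := by simpa using hmul 1 1
  have h0 : D 0 = 0 := by simpa using hadd 0 0
  let φ : R →+* TrivSqZeroExt K K :=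
    { toFun := fun r => TrivSqZeroExt.inl (algebraMap R K r) + TrivSqZeroExt.inr (D r)
      map_one' := by ext <;> simp [h1]
      map_zero' := by ext <;> simp [h0]
      map_add' := fun a b => by ext <;> simp [hadd]
      map_mul' := fun a b => by ext <;> simp [hmul, mul_comm (D a)] }
  obtain ⟨ψ, hψ, hπ⟩ := exists_ringHom_lift hinj φ (TrivSqZeroExt.fstHom K K K).toRingHom
    (fun k => ⟨TrivSqZeroExt.inl k, by simp⟩)
    (fun x y hx hy => by
      have hx : x.fst = 0 := hx
      have hy : y.fst = 0 := hy
      ext <;> simp [hx, hy])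
    (by ext r; simp [φ])
  have hπ : ∀ k, (ψ k).fst = k := hπ
  refine ⟨Derivation.mk' (AddMonoidHom.toIntLinearMap
    { toFun := fun k => (ψ k).snd, map_zero' := by simp, map_add' := by simp }) ?_, ?_⟩
  · intro a b
    simp [hπ, mul_comm b]
  · intro r
    change (ψ _).snd = _
    simp [hψ, φ]

/-- Bounded real sequences, playing the role of Taylor coefficients in one variable. -/
def BddSeq : Type := BoundedContinuousFunction ℕ ℝ

namespace BddSeq

noncomputable section

instance : NormedAddCommGroup BddSeq :=
  inferInstanceAs (NormedAddCommGroup (BoundedContinuousFunction ℕ ℝ))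

instance : NormedSpace ℝ BddSeq := inferInstanceAs (NormedSpace ℝ (BoundedContinuousFunction ℕ ℝ))

instance : CompleteSpace BddSeq := inferInstanceAs (CompleteSpace (BoundedContinuousFunction ℕ ℝ))

/-- Multiplication by the variable: `(a₀, a₁, …) ↦ (0, a₀, a₁, …)`. -/
def rightShift : BddSeq →L[ℝ] BddSeq :=
  LinearMap.mkContinuous (E := BoundedContinuousFunction ℕ ℝ) (F := BoundedContinuousFunction ℕ ℝ)
    { toFun := fun f => BoundedContinuousFunction.ofNormedAddCommGroupDiscrete
        (fun n => Nat.casesOn n 0 f) ‖f‖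
        (fun n => by cases n with
          | zero => simp
          | succ n => exact f.norm_coe_le_norm n)
      map_add' := fun f g => by ext n; cases n <;> simp
      map_smul' := fun c f => by
        ext n
        cases n with
        | zero => exact (mul_zero c).symm
        | succ n => rfl } 1
    (fun f => by
      rw [one_mul]
      refine (BoundedContinuousFunction.norm_le (norm_nonneg f)).2 fun n => ?_
      cases n with
      | zero => exact norm_zero.le.trans (norm_nonneg f)
      | succ n => exact f.norm_coe_le_norm n)

/-- Removal of the constant term: `(a₀, a₁, …) ↦ (a₁, a₂, …)`. -/
def leftShift : BddSeq →L[ℝ] BddSeq :=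
  LinearMap.mkContinuous (E := BoundedContinuousFunction ℕ ℝ) (F := BoundedContinuousFunction ℕ ℝ)
    { toFun := fun f => f.compContinuous ⟨Nat.succ, continuous_of_discreteTopology⟩
      map_add' := fun f g => rfl
      map_smul' := fun c f => rfl } 1
    (fun f => by
      rw [one_mul]
      exact (BoundedContinuousFunction.norm_le (norm_nonneg f)).2
        fun n => f.norm_coe_le_norm (n + 1))

/-- The constant term. -/
def head : BddSeq →L[ℝ] ℝ :=
  BoundedContinuousFunction.evalCLM (α := ℕ) (β := ℝ) ℝ 0

/-- The sequence `(1, 0, 0, …)`. -/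
def unit : BddSeq :=
  BoundedContinuousFunction.ofNormedAddCommGroupDiscrete (fun n : ℕ => if n = 0 then (1 : ℝ) else 0) 1
    (fun n => by split_ifs <;> simp)

@[simp] theorem leftShift_rightShift (f : BddSeq) : leftShift (rightShift f) = f := rfl

@[simp] theorem head_rightShift (f : BddSeq) : head (rightShift f) = 0 := rfl

@[simp] theorem leftShift_unit : leftShift unit = 0 := rfl

@[simp] theorem head_unit : head unit = 1 := rfl

theorem norm_leftShift_le : ‖leftShift‖ ≤ 1 := LinearMap.mkContinuous_norm_le _ zero_le_one _

theorem norm_rightShift_le : ‖rightShift‖ ≤ 1 := LinearMap.mkContinuous_norm_le _ zero_le_one _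

/-- Evaluation of the power series `∑ aⱼ tʲ`. -/
def eval (t : ℝ) : BddSeq →L[ℝ] ℝ := head.comp (Ring.inverse (1 - t • leftShift))

theorem isUnit_one_sub {t : ℝ} (ht : |t| < 1) : IsUnit (1 - t • leftShift) := by
  refine isUnit_one_sub_of_norm_lt_one (R := BddSeq →L[ℝ] BddSeq) ?_
  rw [norm_smul, Real.norm_eq_abs]
  nlinarith [norm_leftShift_le, norm_nonneg leftShift, abs_nonneg t]

theorem eval_eq {t : ℝ} (ht : |t| < 1) (f : BddSeq) :
    eval t f = head f + t * eval t (leftShift f) := by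
  have h := Ring.inverse_mul_cancel _ (isUnit_one_sub ht)
  have h2 := DFunLike.congr_fun h f
  simp only [mul_apply_eq_comp, sub_apply,
    one_apply_eq_self, smul_apply, map_sub, map_smul] at h2
  have h3 := congrArg head h2
  simp only [map_sub, map_smul, smul_eq_mul] at h3
  simp only [eval, ContinuousLinearMap.comp_apply]
  linarith

theorem eval_rightShift {t : ℝ} (ht : |t| < 1) (f : BddSeq) :
    eval t (rightShift f) = t * eval t f := by
  simp [eval_eq ht (rightShift f)]

theorem eval_unit {t : ℝ} (ht : |t| < 1) : eval t unit = 1 := by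
  simp [eval_eq ht unit]

theorem eval_rightShift_pow {t : ℝ} (ht : |t| < 1) (d : ℕ) (f : BddSeq) :
    eval t ((rightShift ^ d) f) = t ^ d * eval t f := by
  induction d with
  | zero => simp
  | succ d ih =>
    rw [pow_succ', mul_apply_eq_comp, eval_rightShift ht, ih, pow_succ']
    ring

/-- Taylor expansion to order `d`. -/
theorem eval_eq_sum {t : ℝ} (ht : |t| < 1) (d : ℕ) (f : BddSeq) :
    eval t f = ∑ j ∈ Finset.range d, head ((leftShift ^ j) f) * t ^ j
      + t ^ d * eval t ((leftShift ^ d) f) := by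
  induction d with
  | zero => simp
  | succ d ih =>
    rw [ih, Finset.sum_range_succ, eval_eq ht ((leftShift ^ d) f), pow_succ' leftShift,
      mul_apply_eq_comp]
    ring

theorem analyticAt_eval {t : ℝ} (ht : |t| < 1) : AnalyticAt ℝ eval t := by
  obtain ⟨u, hu⟩ := isUnit_one_sub ht
  have h1 : AnalyticAt ℝ (fun t : ℝ => (1 - t • leftShift : BddSeq →L[ℝ] BddSeq)) t := by
    exact analyticAt_const.sub (analyticAt_id.smul analyticAt_const)
  have h2 : AnalyticAt ℝ (fun t : ℝ => Ring.inverse (1 - t • leftShift)) t :=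
    AnalyticAt.comp (g := Ring.inverse)
      (by rw [← hu]; exact analyticAt_inverse (A := BddSeq →L[ℝ] BddSeq) u) h1
  exact (ContinuousLinearMap.analyticAt (E := BddSeq →L[ℝ] BddSeq) (F := BddSeq →L[ℝ] ℝ)
    (ContinuousLinearMap.compL ℝ BddSeq BddSeq ℝ head) _).comp h2

end

end BddSeq

noncomputable section
/-- Substitution of elements of a (noncommutative) algebra into a power series in `m` variables. -/
def substSeries {m : ℕ} (𝓐 : Type*) [NormedRing 𝓐] [NormedAlgebra ℝ 𝓐]
    (p : FormalMultilinearSeries ℝ (Fin m → ℝ) ℝ) :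
    FormalMultilinearSeries ℝ (Fin m → 𝓐) 𝓐 := fun n =>
  ∑ i : Fin n → Fin m, p n (fun k => Pi.single (i k) 1) •
    (ContinuousMultilinearMap.mkPiAlgebraFin ℝ n 𝓐).compContinuousLinearMap
      (fun k => ContinuousLinearMap.proj (i k))

section
variable {m : ℕ} {𝓐 : Type*} [NormedRing 𝓐] [NormedAlgebra ℝ 𝓐]
  (p : FormalMultilinearSeries ℝ (Fin m → ℝ) ℝ)

theorem substSeries_apply (n : ℕ) (y : Fin n → Fin m → 𝓐) :
    substSeries 𝓐 p n y = ∑ i : Fin n → Fin m, p n (fun k => Pi.single (i k) 1) •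
      (List.ofFn fun k => y k (i k)).prod := by
  simp [substSeries]

theorem norm_substSeries_le [NormOneClass 𝓐] (n : ℕ) :
    ‖substSeries 𝓐 p n‖ ≤ ‖p n‖ * m ^ n := by
  refine ContinuousMultilinearMap.opNorm_le_bound (by positivity) fun y => ?_
  have h : ∀ i ∈ (Finset.univ : Finset (Fin n → Fin m)),
      ‖p n (fun k => Pi.single (i k) 1) • (List.ofFn fun k => y k (i k)).prod‖
        ≤ ‖p n‖ * ∏ k, ‖y k‖ := by
    intro i _
    rw [norm_smul]
    have h1 : ‖p n (fun k => Pi.single (i k) 1)‖ ≤ ‖p n‖ := by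
      refine ((p n).le_opNorm _).trans ?_
      simp [Pi.norm_single]
    have h2 := (ContinuousMultilinearMap.mkPiAlgebraFin ℝ n 𝓐).le_opNorm fun k => y k (i k)
    rw [ContinuousMultilinearMap.norm_mkPiAlgebraFin, one_mul,
      ContinuousMultilinearMap.mkPiAlgebraFin_apply] at h2
    gcongr
    exact h2.trans (Finset.prod_le_prod (fun _ _ => norm_nonneg _)
      fun k _ => norm_le_pi_norm (y k) (i k))
  rw [substSeries_apply]
  refine (norm_sum_le_of_le _ h).trans (le_of_eq ?_)
  simp only [Finset.sum_const, Finset.card_univ, Fintype.card_fun, Fintype.card_fin, nsmul_eq_mul]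
  push_cast
  ring

theorem substSeries_radius_pos [NormOneClass 𝓐] (hp : 0 < p.radius) :
    0 < (substSeries 𝓐 p).radius := by
  obtain ⟨r, hr0, hr⟩ := ENNReal.lt_iff_exists_nnreal_btwn.1 hp
  obtain ⟨C, hC, h⟩ := p.norm_mul_pow_le_of_lt_radius hr
  have hr0 : 0 < r := by exact_mod_cast hr0
  refine lt_of_lt_of_le (b := ((r / (m + 1) : NNReal) : ENNReal)) ?_ 
    (FormalMultilinearSeries.le_radius_of_bound _ C fun n => ?_)
  · exact_mod_cast (by positivity : 0 < r / (m + 1))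
  · calc _ ≤ (‖p n‖ * m ^ n) * (r / (m + 1) : ℝ) ^ n := by
          push_cast
          gcongr; exact norm_substSeries_le p n
      _ = ‖p n‖ * r ^ n * (m / (m + 1) : ℝ) ^ n := by rw [div_pow, div_pow]; ring
      _ ≤ ‖p n‖ * r ^ n * 1 := by
          gcongr
          exact pow_le_one₀ (by positivity) (by rw [div_le_one (by positivity)]; linarith)
      _ ≤ C := by rw [mul_one]; exact h n

/-- On a common eigenfunctional `ℓ` of the operators `y k`, substitution acts as evaluation. -/
theorem eigen_substSeries {X : Type*} [NormedAddCommGroup X] [NormedSpace ℝ X]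
    (p : FormalMultilinearSeries ℝ (Fin m → ℝ) ℝ) (ℓ : X →L[ℝ] ℝ) (y : Fin m → X →L[ℝ] X)
    (t : Fin m → ℝ) (h : ∀ k z, ℓ (y k z) = t k * ℓ z) (n : ℕ) (z : X) :
    ℓ (substSeries (X →L[ℝ] X) p n (fun _ => y) z) = p n (fun _ => t) * ℓ z := by
  have hprod : ∀ (n : ℕ) (i : Fin n → Fin m) (z : X),
      ℓ ((List.ofFn fun k => y (i k)).prod z) = (∏ k, t (i k)) * ℓ z := by
    intro n
    induction n with
    | zero => intro i z; simp
    | succ n ih =>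
      intro i z
      rw [List.ofFn_succ, List.prod_cons, mul_apply_eq_comp, h, ih,
        Fin.prod_univ_succ, mul_assoc]
  rw [substSeries_apply, sum_apply, map_sum]
  have ht : t = ∑ j, t j • (Pi.single j 1 : Fin m → ℝ) := pi_eq_sum_univ' t
  have hp : p n (fun _ => t) = ∑ i : Fin n → Fin m, (∏ k, t (i k)) *
      p n (fun k => Pi.single (i k) 1) := by
    conv_lhs => rw [ht]
    have := (p n).toMultilinearMap.map_sum (fun (_ : Fin n) (j : Fin m) =>
      t j • (Pi.single j 1 : Fin m → ℝ))
    simp only [ContinuousMultilinearMap.coe_coe] at this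
    rw [this]
    refine Finset.sum_congr rfl fun i _ => ?_
    exact (p n).map_smul_univ (fun k => t (i k)) _
  rw [hp, Finset.sum_mul]
  refine Finset.sum_congr rfl fun i _ => ?_
  rw [smul_apply, map_smul, hprod, smul_eq_mul]
  ring
end
end

theorem AnalyticAt.clm_apply' {E F G : Type*} [NormedAddCommGroup E] [NormedSpace ℝ E]
    [NormedAddCommGroup F] [NormedSpace ℝ F] [NormedAddCommGroup G] [NormedSpace ℝ G]
    {f : E → F →L[ℝ] G} {g : E → F} {x : E} (hf : AnalyticAt ℝ f x) (hg : AnalyticAt ℝ g x) :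
    AnalyticAt ℝ (fun y => f y (g y)) x :=
  AnalyticAt.comp₂ (h := fun p : (F →L[ℝ] G) × F => p.1 p.2)
    ((ContinuousLinearMap.id ℝ (F →L[ℝ] G)).analyticAt_bilinear _) hf hg

instance : Nontrivial BddSeq :=
  ⟨BddSeq.unit, 0, fun h => by simpa using congrArg BddSeq.head h⟩

/-- The operator obtained by substituting bounded operators into a power series. -/
noncomputable def substOp {m : ℕ} (p : FormalMultilinearSeries ℝ (Fin m → ℝ) ℝ) :
    (Fin m → BddSeq →L[ℝ] BddSeq) → (BddSeq →L[ℝ] BddSeq) :=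
  (substSeries (BddSeq →L[ℝ] BddSeq) p).sum

theorem hasFPowerSeriesAt_substOp {m : ℕ} {p : FormalMultilinearSeries ℝ (Fin m → ℝ) ℝ}
    (hp : 0 < p.radius) :
    HasFPowerSeriesAt (substOp p) (substSeries (BddSeq →L[ℝ] BddSeq) p) 0 :=
  ((substSeries (BddSeq →L[ℝ] BddSeq) p).hasFPowerSeriesOnBall
    (substSeries_radius_pos p hp)).hasFPowerSeriesAt

theorem eventually_eigen_substOp {m : ℕ} {g : (Fin m → ℝ) → ℝ}
    {p : FormalMultilinearSeries ℝ (Fin m → ℝ) ℝ} (hg : HasFPowerSeriesAt g p 0) :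
    ∃ ε > 0, AnalyticOnNhd ℝ (substOp p) (Metric.ball 0 ε) ∧
      ∀ (y : Fin m → BddSeq →L[ℝ] BddSeq) (t : Fin m → ℝ) (ℓ : BddSeq →L[ℝ] ℝ),
        ‖y‖ < ε → ‖t‖ < ε → (∀ k z, ℓ (y k z) = t k * ℓ z) →
        ∀ z, ℓ (substOp p y z) = g t * ℓ z := by
  have hH := hasFPowerSeriesAt_substOp hg.radius_pos
  obtain ⟨ε₁, hε₁, h₁⟩ := Metric.eventually_nhds_iff_ball.1 hg.eventually_hasSum
  obtain ⟨ε₂, hε₂, h₂⟩ := Metric.eventually_nhds_iff_ball.1 hH.eventually_hasSum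
  obtain ⟨ε₃, hε₃, h₃⟩ := Metric.eventually_nhds_iff_ball.1 hH.analyticAt.eventually_analyticAt
  refine ⟨min ε₁ (min ε₂ ε₃), by positivity, fun y hy => h₃ y ?_, ?_⟩
  · exact Metric.ball_subset_ball ((min_le_right _ _).trans (min_le_right _ _)) hy
  intro y t ℓ hy ht h z
  have s₁ := h₁ t (by simpa using ht.trans_le (min_le_left _ _))
  have s₂ := h₂ y (by simpa using hy.trans_le ((min_le_right _ _).trans (min_le_left _ _)))
  rw [zero_add] at s₁ s₂
  have s₃ := (s₂.mapL (ContinuousLinearMap.apply ℝ BddSeq z)).mapL ℓ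
  simp only [ContinuousLinearMap.apply_apply, eigen_substSeries p ℓ y t h] at s₃
  exact s₃.unique (s₁.mul_right _)

theorem substSeries_single {m : ℕ} (p : FormalMultilinearSeries ℝ (Fin (m + 1) → ℝ) ℝ)
    (T : BddSeq →L[ℝ] BddSeq) (n : ℕ) :
    substSeries (BddSeq →L[ℝ] BddSeq) p n (fun _ => Pi.single 0 T)
      = p n (fun _ => Pi.single 0 1) • T ^ n := by
  rw [substSeries_apply, Finset.sum_eq_single (fun _ => 0)]
  · simp
  · intro i _ hi
    obtain ⟨k, hk⟩ := Function.ne_iff.1 hi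
    rw [List.prod_eq_zero, smul_zero]
    exact List.mem_ofFn.2 ⟨k, by rw [Pi.single_apply, if_neg hk]⟩
  · simp

theorem exists_coeff_ne_zero {m : ℕ} {g : (Fin (m + 1) → ℝ) → ℝ}
    {p : FormalMultilinearSeries ℝ (Fin (m + 1) → ℝ) ℝ} (hg : HasFPowerSeriesAt g p 0)
    (hne : ¬ ∀ᶠ t : ℝ in 𝓝 0, g (Pi.single 0 t) = 0) : ∃ n, p n (fun _ => Pi.single 0 1) ≠ 0 := by
  contrapose! hne
  have hc : Tendsto (fun t : ℝ => (Pi.single 0 t : Fin (m + 1) → ℝ)) (𝓝 0) (𝓝 0) :=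
    (continuous_single 0).tendsto' _ _ (Pi.single_zero 0)
  filter_upwards [hc.eventually hg.eventually_hasSum] with t ht
  rw [zero_add] at ht
  refine ht.unique ?_
  convert! hasSum_zero with n
  have : (Pi.single 0 t : Fin (m + 1) → ℝ) = t • Pi.single 0 1 := by
    rw [← Pi.single_smul, smul_eq_mul, mul_one]
  rw [this, (p n).map_smul_univ (fun _ => t) (fun _ => Pi.single 0 1), hne n, smul_zero]

/-- If `d` is the order of vanishing of the series along the first axis, then up to the leading
coefficient the substitution of `ρ • T` is `(ρ • T) ^ d` to first order. -/
theorem tendsto_substOp_single {m : ℕ} {p : FormalMultilinearSeries ℝ (Fin (m + 1) → ℝ) ℝ}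
    (hp : 0 < p.radius) {d : ℕ} (hd : p d (fun _ => Pi.single 0 1) ≠ 0)
    (hlt : ∀ n < d, p n (fun _ => Pi.single 0 1) = 0) (T : BddSeq →L[ℝ] BddSeq) :
    Tendsto (fun ρ : ℝ => (ρ ^ d * p d (fun _ => Pi.single 0 1))⁻¹ •
      substOp p (Pi.single 0 (ρ • T))) (𝓝[>] 0) (𝓝 (T ^ d)) := by
  set a := p d (fun _ => Pi.single 0 1) with ha
  have hH := (hasFPowerSeriesAt_substOp hp).isBigO_sub_partialSum_pow (d + 1)
  have hc : Tendsto (fun ρ : ℝ => (Pi.single 0 (ρ • T) : Fin (m + 1) → BddSeq →L[ℝ] BddSeq))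
      (𝓝[>] 0) (𝓝 0) := by
    have h1 : Continuous (fun ρ : ℝ => (ρ • T : BddSeq →L[ℝ] BddSeq)) :=
      continuous_id.smul continuous_const
    refine Tendsto.mono_left ?_ nhdsWithin_le_nhds
    exact ((continuous_single (A := fun _ => BddSeq →L[ℝ] BddSeq) 0).comp h1).tendsto' _ _
      (by simp)
  obtain ⟨C, hC⟩ := (hH.comp_tendsto hc).bound
  rw [tendsto_iff_norm_sub_tendsto_zero]
  refine squeeze_zero' (g := fun ρ : ℝ => |a|⁻¹ * (C * ‖T‖ ^ (d + 1)) * ρ)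
    (Eventually.of_forall fun _ => norm_nonneg _) ?_ ?_
  · filter_upwards [hC, self_mem_nhdsWithin] with ρ hρ hpos
    have hpos : 0 < ρ := hpos
    have hpart : (substSeries (BddSeq →L[ℝ] BddSeq) p).partialSum (d + 1)
        (Pi.single 0 (ρ • T)) = (ρ ^ d * a) • T ^ d := by
      rw [FormalMultilinearSeries.partialSum, Finset.sum_range_succ, Finset.sum_eq_zero, zero_add,
        substSeries_single, smul_pow, smul_smul, mul_comm a]
      intro n hn
      rw [substSeries_single, hlt n (Finset.mem_range.1 hn), zero_smul]
    simp only [Function.comp_apply, zero_add, hpart, Pi.norm_single, norm_pow, norm_smul,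
      Real.norm_eq_abs, abs_mul, abs_norm, abs_of_pos hpos] at hρ
    have hne : ρ ^ d * a ≠ 0 := mul_ne_zero (by positivity) hd
    have : (ρ ^ d * a)⁻¹ • substOp p (Pi.single 0 (ρ • T)) - T ^ d
        = (ρ ^ d * a)⁻¹ • (substOp p (Pi.single 0 (ρ • T)) - (ρ ^ d * a) • T ^ d) := by
      rw [smul_sub, inv_smul_smul₀ hne]
    rw [this, norm_smul, norm_inv, norm_mul, norm_pow, Real.norm_eq_abs, Real.norm_eq_abs,
      abs_of_pos hpos]
    calc _ ≤ (ρ ^ d * |a|)⁻¹ * (C * (ρ * ‖T‖) ^ (d + 1)) := by gcongr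
      _ = _ := by
        have : |a| ≠ 0 := abs_ne_zero.2 hd
        rw [mul_pow]
        field_simp
        ring
  · refine Tendsto.mono_left ?_ nhdsWithin_le_nhds
    exact (continuous_const.mul continuous_id).tendsto' _ _ (by simp)

/-- Weierstrass division for germs of real-analytic functions. -/
theorem weierstrass_division {m : ℕ} {g : (Fin (m + 1) → ℝ) → ℝ} (hg : AnalyticAt ℝ g 0)
    (hne : ¬ ∀ᶠ t : ℝ in 𝓝 0, g (Pi.single 0 t) = 0) :
    ∃ d : ℕ, ∀ h : (Fin (m + 1) → ℝ) → ℝ, AnalyticAt ℝ h 0 →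
      ∃ (q : (Fin (m + 1) → ℝ) → ℝ) (r : ℕ → (Fin m → ℝ) → ℝ), AnalyticAt ℝ q 0 ∧
        (∀ j, AnalyticAt ℝ (r j) 0) ∧ ∀ᶠ v in 𝓝 0,
          h v = q v * g v + ∑ j ∈ Finset.range d, r j (Fin.tail v) * v 0 ^ j := by
  classical
  obtain ⟨p, hp⟩ := hg
  have hex := exists_coeff_ne_zero hp hne
  set d := Nat.find hex with hd
  refine ⟨d, fun h ⟨p', hp'⟩ => ?_⟩
  obtain ⟨ε₁, hε₁, han₁, heig₁⟩ := eventually_eigen_substOp hp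
  obtain ⟨ε₂, hε₂, han₂, heig₂⟩ := eventually_eigen_substOp hp'
  have hlim := tendsto_substOp_single hp.radius_pos (Nat.find_spec hex)
    (fun n hn => not_not.1 (Nat.find_min hex hn)) BddSeq.rightShift
  rw [← hd] at hlim
  set ε := min ε₁ ε₂
  have hε : 0 < ε := lt_min hε₁ hε₂
  obtain ⟨ρ, ⟨hρ₁, hρ₀, hρε⟩⟩ := ((hlim.eventually (Metric.ball_mem_nhds _ one_pos)).and
    (Ioo_mem_nhdsGT hε)).exists
  set c := (ρ ^ d * p d fun _ => Pi.single 0 1)⁻¹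
  let S := BddSeq.rightShift
  let B := BddSeq.leftShift
  let y : (Fin m → ℝ) → Fin (m + 1) → BddSeq →L[ℝ] BddSeq := fun x =>
    Fin.cons (ρ • S) fun i => x i • 1
  have hyan : AnalyticAt ℝ y 0 := by
    refine analyticAt_pi_iff.2 fun k => ?_
    refine Fin.cases ?_ (fun i => ?_) k
    · exact analyticAt_const
    · exact ((ContinuousLinearMap.proj (R := ℝ) (φ := fun _ : Fin m => ℝ) i).analyticAt 0).smul
        analyticAt_const
  have hy0 : y 0 = Pi.single 0 (ρ • S) := by
    funext k
    refine Fin.cases ?_ (fun i => ?_) k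
    · simp [y]
    · simp [y]
  have hy0n : ‖y 0‖ < ε := by
    rw [hy0, Pi.norm_single, norm_smul, Real.norm_eq_abs, abs_of_pos hρ₀]
    nlinarith [BddSeq.norm_rightShift_le]
  have hyn : ∀ᶠ x in 𝓝 0, ‖y x‖ < ε :=
    hyan.continuousAt.norm.eventually (gt_mem_nhds hy0n)
  let Φ : (Fin m → ℝ) → BddSeq →L[ℝ] BddSeq := fun x =>
    c • (substOp p (y x) * B ^ d) + (1 - S ^ d * B ^ d)
  have hΦan : AnalyticAt ℝ Φ 0 := by
    have h1 : AnalyticAt ℝ (fun x => substOp p (y x)) 0 :=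
      (han₁ (y 0) (by simpa using hy0n.trans_le (min_le_left _ _))).comp hyan
    have h2 : AnalyticAt ℝ (fun x => substOp p (y x) * B ^ d) 0 := h1.mul analyticAt_const
    have h3 : AnalyticAt ℝ (fun x => c • (substOp p (y x) * B ^ d)) 0 :=
      h2.fun_const_smul
    exact h3.add analyticAt_const
  have hΦ0 : IsUnit (Φ 0) := by
    have : Φ 0 = 1 - (S ^ d - c • substOp p (Pi.single 0 (ρ • S))) * B ^ d := by
      simp only [Φ, hy0, sub_mul, smul_mul_assoc]
      abel
    rw [this]
    refine isUnit_one_sub_of_norm_lt_one ((norm_mul_le _ _).trans_lt ?_)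
    have h1 : ‖S ^ d - c • substOp p (Pi.single 0 (ρ • S))‖ < 1 := by
      rw [norm_sub_rev, ← dist_eq_norm]
      exact hρ₁
    have h2 : ‖B ^ d‖ ≤ 1 :=
      (norm_pow_le B d).trans (pow_le_one₀ (norm_nonneg _) BddSeq.norm_leftShift_le)
    exact (mul_le_of_le_one_right (norm_nonneg _) h2).trans_lt h1
  have hΦu : ∀ᶠ x in 𝓝 0, IsUnit (Φ x) :=
    hΦan.continuousAt.eventually (Units.isOpen.mem_nhds hΦ0)
  let Z : (Fin m → ℝ) → BddSeq := fun x => Ring.inverse (Φ x) (substOp p' (y x) BddSeq.unit)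
  have hZan : AnalyticAt ℝ Z 0 := by
    obtain ⟨u, hu⟩ := hΦ0
    have h1 : AnalyticAt ℝ (fun x => Ring.inverse (Φ x)) 0 :=
      AnalyticAt.comp (g := Ring.inverse)
        (by rw [← hu]; exact analyticAt_inverse (A := BddSeq →L[ℝ] BddSeq) u) hΦan
    have h2 : AnalyticAt ℝ (fun x => substOp p' (y x)) 0 :=
      (han₂ (y 0) (by simpa using hy0n.trans_le (min_le_right _ _))).comp hyan
    exact h1.clm_apply' (h2.clm_apply' analyticAt_const)
  let tl : (Fin (m + 1) → ℝ) →L[ℝ] (Fin m → ℝ) :=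
    ContinuousLinearMap.pi fun i => ContinuousLinearMap.proj i.succ
  have htl : ∀ v, tl v = Fin.tail v := fun v => rfl
  have htl0 : Tendsto (fun v => Fin.tail v) (𝓝 (0 : Fin (m + 1) → ℝ)) (𝓝 0) :=
    tl.continuous.tendsto' _ _ (map_zero tl)
  refine ⟨fun v => BddSeq.eval (ρ⁻¹ * v 0) ((c • B ^ d) (Z (Fin.tail v))),
    fun j x => (ρ ^ j)⁻¹ * BddSeq.head ((B ^ j) (Z x)), ?_, fun j => ?_, ?_⟩
  · have h1 : AnalyticAt ℝ (fun v : Fin (m + 1) → ℝ => ρ⁻¹ * v 0) 0 := analyticAt_const.mul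
      ((ContinuousLinearMap.proj (R := ℝ) (φ := fun _ : Fin (m + 1) => ℝ) 0).analyticAt 0)
    have h2 : AnalyticAt ℝ (fun v => Z (tl v)) 0 :=
      AnalyticAt.comp (g := Z) (by rwa [map_zero]) (tl.analyticAt 0)
    exact AnalyticAt.clm_apply'
      (AnalyticAt.comp (g := BddSeq.eval) (BddSeq.analyticAt_eval (by simp)) h1)
      (analyticAt_const.clm_apply' h2)
  · exact analyticAt_const.mul
      (analyticAt_const.clm_apply' (analyticAt_const.clm_apply' hZan))
  · have hv0 : ∀ᶠ v : Fin (m + 1) → ℝ in 𝓝 0, |v 0| < ρ :=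
      ((continuous_apply 0).abs.tendsto' (0 : Fin (m + 1) → ℝ) 0 (by simp)).eventually
        (gt_mem_nhds hρ₀)
    have hvε : ∀ᶠ v : Fin (m + 1) → ℝ in 𝓝 0, ‖v‖ < ε :=
      (continuous_norm.tendsto' _ _ norm_zero).eventually (gt_mem_nhds hε)
    filter_upwards [hv0, hvε, htl0.eventually hyn, htl0.eventually hΦu] with v hv₀ hvε hyv hu
    set x := Fin.tail v
    set s := ρ⁻¹ * v 0 with hs
    have hs1 : |s| < 1 := by
      rw [hs, abs_mul, abs_inv, abs_of_pos hρ₀]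
      rw [inv_mul_lt_iff₀ hρ₀]
      linarith
    have hvs : v 0 = ρ * s := by rw [hs, mul_inv_cancel_left₀ hρ₀.ne']
    have heig : ∀ k z, BddSeq.eval s (y x k z) = v k * BddSeq.eval s z := by
      intro k z
      refine Fin.cases ?_ (fun i => ?_) k
      · simp only [y, Fin.cons_zero, smul_apply, map_smul, S, BddSeq.eval_rightShift hs1,
          smul_eq_mul]
        rw [hvs]
        ring
      · simp [y, x, Fin.tail]
    have e₁ := heig₁ (y x) v (BddSeq.eval s) (hyv.trans_le (min_le_left _ _))
      (hvε.trans_le (min_le_left _ _)) heig ((B ^ d) (Z x))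
    have e₂ := heig₂ (y x) v (BddSeq.eval s) (hyv.trans_le (min_le_right _ _))
      (hvε.trans_le (min_le_right _ _)) heig BddSeq.unit
    rw [BddSeq.eval_unit hs1, mul_one] at e₂
    have e₃ : Φ x (Z x) = substOp p' (y x) BddSeq.unit :=
      DFunLike.congr_fun (Ring.mul_inverse_cancel _ hu) (substOp p' (y x) BddSeq.unit)
    have e₄ := BddSeq.eval_eq_sum hs1 d (Z x)
    rw [← e₂, ← e₃]
    have e₅ : ∀ j, (ρ ^ j)⁻¹ * BddSeq.head ((B ^ j) (Z x)) * v 0 ^ j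
        = BddSeq.head ((B ^ j) (Z x)) * s ^ j := by
      intro j
      rw [hs, mul_pow, inv_pow]
      ring
    simp only [e₅, Φ, add_apply, sub_apply, smul_apply, mul_apply_eq_comp, one_apply_eq_self,
      map_add, map_sub, map_smul, smul_eq_mul, e₁, S, BddSeq.eval_rightShift_pow hs1]
    linarith

section GermAlgebra

variable {E F K : Type*} [NormedAddCommGroup E] [NormedAddCommGroup F] [Field K] [Algebra ℝ K]

/-- Precomposition with a map, as a homomorphism of algebras of functions. -/
def pullback {X Y : Type*} (π : X → Y) : (Y → ℝ) →ₐ[ℝ] (X → ℝ) :=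
  AlgHom.pi fun x => Pi.evalAlgHom ℝ _ (π x)

@[simp]
theorem pullback_apply {X Y : Type*} (π : X → Y) (g : Y → ℝ) (x : X) :
    pullback π g x = g (π x) := rfl

/-- The homomorphism `Φ` only depends on germs at the origin. -/
def FactorsThroughGerms (Φ : (E → ℝ) →ₐ[ℝ] K) : Prop :=
  ∀ g : E → ℝ, g =ᶠ[𝓝 0] 0 → Φ g = 0

namespace FactorsThroughGerms

variable {Φ : (E → ℝ) →ₐ[ℝ] K}

theorem congr (hΦ : FactorsThroughGerms Φ) {g h : E → ℝ} (hgh : g =ᶠ[𝓝 0] h) : Φ g = Φ h := by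
  rw [← sub_eq_zero, ← map_sub]
  refine hΦ _ ?_
  filter_upwards [hgh] with x hx
  simp [hx]

theorem comp_pullback (hΦ : FactorsThroughGerms Φ) {π : E → F} (hπ : ContinuousAt π 0)
    (hπ0 : π 0 = 0) : FactorsThroughGerms (Φ.comp (pullback π)) := by
  intro g hg
  refine hΦ _ ?_
  have : Tendsto π (𝓝 0) (𝓝 0) := by simpa [ContinuousAt, hπ0] using hπ
  filter_upwards [this.eventually hg] with x hx
  simpa using hx

theorem apply_zero_eq_zero (hΦ : FactorsThroughGerms Φ) {g : E → ℝ} (hg : ContinuousAt g 0)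
    (h : Φ g = 0) : g 0 = 0 := by
  by_contra h0
  have h1 : Φ (g * g⁻¹) = Φ 1 := by
    refine hΦ.congr ?_
    filter_upwards [hg.eventually_ne h0] with x hx
    simp [hx]
  rw [map_mul, h, zero_mul, map_one] at h1
  exact zero_ne_one h1

end FactorsThroughGerms

variable [NormedSpace ℝ E]

/-- The image in `K` of the algebra of functions that are analytic at the origin. -/
def analyticImage (Φ : (E → ℝ) →ₐ[ℝ] K) : Subalgebra ℝ K :=
  Subalgebra.map Φ
    { carrier := {g | AnalyticAt ℝ g 0}
      mul_mem' := fun ha hb => AnalyticAt.mul ha hb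
      add_mem' := fun ha hb => AnalyticAt.add ha hb
      algebraMap_mem' := fun _ => analyticAt_const }

/-- The derivation `D` of `K` acts on images of analytic functions through their directional
derivatives. -/
def IsChainRuleDerivation (Φ : (E → ℝ) →ₐ[ℝ] K) (D : Derivation ℤ K K) : Prop :=
  ∃ Λ : (E → K) →ₗ[K] K, ∀ g, AnalyticAt ℝ g 0 →
    D (Φ g) = Λ fun u => Φ fun y => fderiv ℝ g y u

theorem mem_analyticImage {Φ : (E → ℝ) →ₐ[ℝ] K} {a : K} :
    a ∈ analyticImage Φ ↔ ∃ g, AnalyticAt ℝ g 0 ∧ Φ g = a := Iff.rfl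

namespace FactorsThroughGerms

variable {Φ : (E → ℝ) →ₐ[ℝ] K}

theorem map_fderiv_congr (hΦ : FactorsThroughGerms Φ) {g h : E → ℝ} (hgh : g =ᶠ[𝓝 0] h) (u : E) :
    Φ (fun y => fderiv ℝ g y u) = Φ fun y => fderiv ℝ h y u := by
  refine hΦ.congr ?_
  filter_upwards [hgh.fderiv (𝕜 := ℝ)] with x hx
  rw [hx]

theorem map_fderiv_add (hΦ : FactorsThroughGerms Φ) {g h : E → ℝ} (hg : AnalyticAt ℝ g 0)
    (hh : AnalyticAt ℝ h 0) (u : E) :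
    Φ (fun y => fderiv ℝ (g + h) y u)
      = Φ (fun y => fderiv ℝ g y u) + Φ fun y => fderiv ℝ h y u := by
  rw [← map_add]
  refine hΦ.congr ?_
  filter_upwards [hg.eventually_analyticAt, hh.eventually_analyticAt] with x h1 h2
  simp [fderiv_add h1.differentiableAt h2.differentiableAt]

theorem map_fderiv_mul (hΦ : FactorsThroughGerms Φ) {g h : E → ℝ} (hg : AnalyticAt ℝ g 0)
    (hh : AnalyticAt ℝ h 0) (u : E) :
    Φ (fun y => fderiv ℝ (g * h) y u)
      = Φ g * Φ (fun y => fderiv ℝ h y u) + Φ h * Φ fun y => fderiv ℝ g y u := by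
  rw [← map_mul, ← map_mul, ← map_add]
  refine hΦ.congr ?_
  filter_upwards [hg.eventually_analyticAt, hh.eventually_analyticAt] with x h1 h2
  simp [fderiv_mul h1.differentiableAt h2.differentiableAt]

/-- The functions on which a derivation of `K` is given by a prescribed linear combination of
directional derivatives form a subring. -/
def chainRuleSubring (hΦ : FactorsThroughGerms Φ) (D : Derivation ℤ K K)
    (Λ : (E → K) →ₗ[K] K) : Subring (E → ℝ) where
  carrier := {g | AnalyticAt ℝ g 0 ∧ D (Φ g) = Λ fun u => Φ fun y => fderiv ℝ g y u}
  zero_mem' := ⟨analyticAt_const, by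
    have : (fun u => Φ fun y => fderiv ℝ (0 : E → ℝ) y u) = 0 := by
      funext u
      rw [Pi.zero_apply, ← map_zero Φ]
      congr 1
      funext y
      simp
    rw [this]
    simp⟩
  one_mem' := ⟨analyticAt_const, by
    have : (fun u => Φ fun y => fderiv ℝ (1 : E → ℝ) y u) = 0 := by
      funext u
      rw [Pi.zero_apply, ← map_zero Φ]
      congr 1
      funext y
      simp
    rw [this]
    simp⟩
  add_mem' := by
    rintro g h ⟨hg, hg'⟩ ⟨hh, hh'⟩
    refine ⟨hg.add hh, ?_⟩
    rw [map_add, map_add, hg', hh', ← map_add]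
    congr 1
    funext u
    exact (hΦ.map_fderiv_add hg hh u).symm
  mul_mem' := by
    rintro g h ⟨hg, hg'⟩ ⟨hh, hh'⟩
    refine ⟨hg.mul hh, ?_⟩
    rw [map_mul, D.leibniz, hg', hh', ← map_smul, ← map_smul, ← map_add]
    congr 1
    funext u
    exact (hΦ.map_fderiv_mul hg hh u).symm
  neg_mem' := by
    rintro g ⟨hg, hg'⟩
    refine ⟨hg.neg, ?_⟩
    rw [map_neg, map_neg, hg', ← map_neg]
    congr 1
    funext u
    change -Φ _ = Φ _
    rw [← map_neg]
    congr 1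
    funext y
    simp [fderiv_neg]

end FactorsThroughGerms

end GermAlgebra

open Polynomial in
theorem monic_X_pow_sub_sum {R : Type*} [CommRing R] (a : ℕ → R) (d : ℕ) :
    (X ^ d - ∑ j ∈ Finset.range d, C (a j) * X ^ j : R[X]).Monic := by
  refine monic_X_pow_sub (mem_degreeLT.1 (sum_mem fun j hj => mem_degreeLT.2 ?_))
  exact (degree_C_mul_X_pow_le _ _).trans_lt (by exact_mod_cast Finset.mem_range.1 hj)

section NoetherNormalization

variable {K : Type*} [Field K] [Algebra ℝ K]

/-- Dropping the first coordinate, as a continuous linear map. -/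
def tailCLM (m : ℕ) : (Fin (m + 1) → ℝ) →L[ℝ] (Fin m → ℝ) :=
  ContinuousLinearMap.pi fun i => ContinuousLinearMap.proj i.succ

theorem tailCLM_apply {m : ℕ} (v : Fin (m + 1) → ℝ) : tailCLM m v = Fin.tail v := rfl

/-- The polynomial in the first coordinate whose coefficients are functions of the others. -/
def polyInHead {m : ℕ} (r : ℕ → (Fin m → ℝ) → ℝ) (d : ℕ) : (Fin (m + 1) → ℝ) → ℝ :=
  ∑ j ∈ Finset.range d, pullback (tailCLM m) (r j) * (fun v => v 0) ^ j

theorem polyInHead_apply {m : ℕ} (r : ℕ → (Fin m → ℝ) → ℝ) (d : ℕ) (v : Fin (m + 1) → ℝ) :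
    polyInHead r d v = ∑ j ∈ Finset.range d, r j (Fin.tail v) * v 0 ^ j := by
  simp [polyInHead, tailCLM_apply]

theorem analyticAt_head {m : ℕ} : AnalyticAt ℝ (fun v : Fin (m + 1) → ℝ => v 0) 0 :=
  (ContinuousLinearMap.proj (R := ℝ) (φ := fun _ : Fin (m + 1) => ℝ) 0).analyticAt 0

theorem analyticAt_pullback_tailCLM {m : ℕ} {g : (Fin m → ℝ) → ℝ} (hg : AnalyticAt ℝ g 0) :
    AnalyticAt ℝ (pullback (tailCLM m) g) 0 :=
  AnalyticAt.comp (g := g) (by rwa [map_zero]) ((tailCLM m).analyticAt 0)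

theorem analyticAt_polyInHead {m : ℕ} {r : ℕ → (Fin m → ℝ) → ℝ} (hr : ∀ j, AnalyticAt ℝ (r j) 0)
    (d : ℕ) : AnalyticAt ℝ (polyInHead r d) 0 :=
  Finset.analyticAt_sum _ fun j _ =>
    (analyticAt_pullback_tailCLM (hr j)).mul (analyticAt_head.pow j)

/-- If a function regular in the first coordinate is killed, so is a Weierstrass polynomial. -/
theorem exists_weierstrass_polynomial {m : ℕ} {Φ : ((Fin (m + 1) → ℝ) → ℝ) →ₐ[ℝ] K}
    (hΦ : FactorsThroughGerms Φ) {g : (Fin (m + 1) → ℝ) → ℝ} (hg : AnalyticAt ℝ g 0)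
    (hne : ¬ ∀ᶠ t : ℝ in 𝓝 0, g (Pi.single 0 t) = 0) (hΦg : Φ g = 0) :
    ∃ (d : ℕ) (r : ℕ → (Fin m → ℝ) → ℝ), (∀ j, AnalyticAt ℝ (r j) 0) ∧
      Φ ((fun v => v 0) ^ d - polyInHead r d) = 0 := by
  obtain ⟨d, hd⟩ := weierstrass_division hg hne
  obtain ⟨q, r, -, hr, h⟩ := hd ((fun v => v 0) ^ d) (analyticAt_head.pow d)
  refine ⟨d, r, hr, ?_⟩
  have : Φ ((fun v => v 0) ^ d - polyInHead r d) = Φ (q * g) := by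
    refine hΦ.congr ?_
    filter_upwards [h] with v hv
    rw [Pi.sub_apply, hv, polyInHead_apply, Pi.mul_apply]
    ring
  rw [this, map_mul, hΦg, mul_zero]

open Polynomial in
theorem not_eventually_weierstrass_polynomial_eq_zero {m : ℕ} (d : ℕ)
    (r : ℕ → (Fin m → ℝ) → ℝ) :
    ¬ ∀ᶠ t : ℝ in 𝓝 0, ((fun v : Fin (m + 1) → ℝ => v 0) ^ d - polyInHead r d)
      (Pi.single 0 t) = 0 := by
  intro h
  set p : ℝ[X] := X ^ d - ∑ j ∈ Finset.range d, C (r j 0) * X ^ j with hp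
  have hmon : p.Monic := monic_X_pow_sub_sum _ d
  refine hmon.ne_zero (eq_zero_of_infinite_isRoot p ?_)
  refine (infinite_of_mem_nhds (0 : ℝ) h).mono fun t ht => ?_
  have ht : _ - _ = (0 : ℝ) := ht
  have htail : Fin.tail (Pi.single 0 t : Fin (m + 1) → ℝ) = 0 := by
    funext i
    simp [Fin.tail]
  rw [polyInHead_apply, htail] at ht
  simpa [hp, IsRoot, eval_finsetSum] using ht

/-- If a function regular in the first coordinate is killed by `Φ`, then the image of `Φ` is
integral over the image of the functions of the remaining coordinates. -/
theorem isIntegral_analyticImage_tail {m : ℕ} {Φ : ((Fin (m + 1) → ℝ) → ℝ) →ₐ[ℝ] K}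
    (hΦ : FactorsThroughGerms Φ) {g : (Fin (m + 1) → ℝ) → ℝ} (hg : AnalyticAt ℝ g 0)
    (hne : ¬ ∀ᶠ t : ℝ in 𝓝 0, g (Pi.single 0 t) = 0) (hΦg : Φ g = 0)
    {h : (Fin (m + 1) → ℝ) → ℝ} (hh : AnalyticAt ℝ h 0) :
    IsIntegral (analyticImage (Φ.comp (pullback (tailCLM m)))) (Φ h) := by
  set R := analyticImage (Φ.comp (pullback (tailCLM m)))
  have hR : ∀ {r : (Fin m → ℝ) → ℝ}, AnalyticAt ℝ r 0 → Φ (pullback (tailCLM m) r) ∈ R :=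
    fun {r} hr => ⟨r, hr, rfl⟩
  have hcoeff : ∀ {r : (Fin m → ℝ) → ℝ}, AnalyticAt ℝ r 0 →
      IsIntegral R (Φ (pullback (tailCLM m) r)) :=
    fun hr => isIntegral_algebraMap (x := (⟨_, hR hr⟩ : R))
  obtain ⟨d, r, hr, hw⟩ := exists_weierstrass_polynomial hΦ hg hne hΦg
  have hτ : IsIntegral R (Φ fun v => v 0) := by
    refine ⟨Polynomial.X ^ d - ∑ j ∈ Finset.range d,
      Polynomial.C (⟨_, hR (hr j)⟩ : R) * Polynomial.X ^ j, monic_X_pow_sub_sum _ d, ?_⟩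
    rw [polyInHead, map_sub, map_pow, map_sum] at hw
    simpa [Polynomial.eval₂_finsetSum] using hw
  obtain ⟨e, he⟩ := weierstrass_division
    ((analyticAt_head.pow d).sub (analyticAt_polyInHead hr d))
    (not_eventually_weierstrass_polynomial_eq_zero d r)
  obtain ⟨q, s, -, hs, h'⟩ := he h hh
  have : Φ h = Φ (q * ((fun v => v 0) ^ d - polyInHead r d) + polyInHead s e) := by
    refine hΦ.congr ?_
    filter_upwards [h'] with v hv
    rw [hv, Pi.add_apply, polyInHead_apply s, Pi.mul_apply]
  rw [this, map_add, map_mul, hw, mul_zero, zero_add, polyInHead, map_sum]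
  refine IsIntegral.sum _ fun j _ => ?_
  rw [map_mul, map_pow]
  exact (hcoeff (hs j)).mul (hτ.pow j)

theorem IsChainRuleDerivation.of_tail {m : ℕ} {Φ : ((Fin (m + 1) → ℝ) → ℝ) →ₐ[ℝ] K}
    (hΦ : FactorsThroughGerms Φ) {g : (Fin (m + 1) → ℝ) → ℝ} (hg : AnalyticAt ℝ g 0)
    (hne : ¬ ∀ᶠ t : ℝ in 𝓝 0, g (Pi.single 0 t) = 0) (hΦg : Φ g = 0)
    {D : Derivation ℤ K K} (hD : IsChainRuleDerivation (Φ.comp (pullback (tailCLM m))) D) :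
    IsChainRuleDerivation Φ D := by
  obtain ⟨Λ', hΛ'⟩ := hD
  let ι : (Fin m → ℝ) → Fin (m + 1) → ℝ := fun x => Fin.cons 0 x
  let Λ : ((Fin (m + 1) → ℝ) → K) →ₗ[K] K :=
    Λ'.comp (LinearMap.funLeft K K ι) + D (Φ fun v => v 0) • LinearMap.proj (Pi.single 0 1)
  have hΛ : ∀ φ, Λ φ = Λ' (fun x => φ (ι x)) + D (Φ fun v => v 0) * φ (Pi.single 0 1) :=
    fun φ => rfl
  have hhead : (fun v => v 0) ∈ hΦ.chainRuleSubring D Λ := by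
    refine ⟨analyticAt_head, ?_⟩
    have : ∀ u : Fin (m + 1) → ℝ, (Φ fun y => fderiv ℝ (fun v : Fin (m + 1) → ℝ => v 0) y u)
        = algebraMap ℝ K (u 0) := by
      intro u
      rw [← AlgHom.commutes Φ]
      congr 1
      funext y
      exact DFunLike.congr_fun (ContinuousLinearMap.fderiv
        (ContinuousLinearMap.proj (R := ℝ) (φ := fun _ : Fin (m + 1) => ℝ) 0)) u
    simp only [hΛ, this]
    have h0 : (fun x : Fin m → ℝ => algebraMap ℝ K (ι x 0)) = 0 := by
      funext x
      simp [ι]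
    simp [h0]
  have htail : ∀ {r : (Fin m → ℝ) → ℝ}, AnalyticAt ℝ r 0 →
      pullback (tailCLM m) r ∈ hΦ.chainRuleSubring D Λ := by
    intro r hr
    refine ⟨analyticAt_pullback_tailCLM hr, ?_⟩
    have hcomp : ∀ u : Fin (m + 1) → ℝ,
        (Φ fun y => fderiv ℝ (pullback (tailCLM m) r) y u)
          = Φ (pullback (tailCLM m) fun y => fderiv ℝ r y (tailCLM m u)) := by
      intro u
      refine hΦ.congr ?_
      have : Tendsto (tailCLM m) (𝓝 0) (𝓝 0) :=
        (tailCLM m).continuous.tendsto' _ _ (map_zero _)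
      filter_upwards [this.eventually hr.eventually_analyticAt] with y hy
      have : fderiv ℝ (r ∘ tailCLM m) y = _ :=
        fderiv_comp y hy.differentiableAt (tailCLM m).differentiableAt
      change fderiv ℝ (r ∘ tailCLM m) y u = _
      rw [this]
      simp
    simp only [hΛ, hcomp]
    have h0 : tailCLM m (Pi.single 0 1) = 0 := by
      funext i
      simp [tailCLM_apply, Fin.tail]
    have h1 : ∀ x, tailCLM m (ι x) = x := fun x => rfl
    have h2 : Φ (pullback (tailCLM m) fun y => fderiv ℝ r y 0) = 0 := by
      rw [← map_zero Φ]
      congr 1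
      funext y
      simp
    rw [h0, h2, mul_zero, add_zero]
    simp only [h1]
    exact hΛ' r hr
  have hpoly : ∀ {r : ℕ → (Fin m → ℝ) → ℝ}, (∀ j, AnalyticAt ℝ (r j) 0) → ∀ d,
      polyInHead r d ∈ hΦ.chainRuleSubring D Λ := fun hr d =>
    sum_mem fun j _ => mul_mem (htail (hr j)) (pow_mem hhead j)
  obtain ⟨d, r, hr, hw⟩ := exists_weierstrass_polynomial hΦ hg hne hΦg
  have hwmem : ((fun v => v 0) ^ d - polyInHead r d) ∈ hΦ.chainRuleSubring D Λ :=
    sub_mem (pow_mem hhead d) (hpoly hr d)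
  obtain ⟨e, he⟩ := weierstrass_division hwmem.1
    (not_eventually_weierstrass_polynomial_eq_zero d r)
  set w : (Fin (m + 1) → ℝ) → ℝ := (fun v => v 0) ^ d - polyInHead r d
  refine ⟨Λ, fun h hh => ?_⟩
  obtain ⟨q, s, hq, hs, h'⟩ := he h hh
  have heq : h =ᶠ[𝓝 0] q * w + polyInHead s e := by
    filter_upwards [h'] with v hv
    rw [hv, Pi.add_apply, polyInHead_apply, Pi.mul_apply]
  have hsmem := hpoly hs e
  have hδw : Λ (fun u => Φ fun y => fderiv ℝ w y u) = 0 := by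
    rw [← hwmem.2, hw, map_zero]
  have hδ : (fun u => Φ fun y => fderiv ℝ h y u)
      = Φ q • (fun u => Φ fun y => fderiv ℝ w y u)
        + fun u => Φ fun y => fderiv ℝ (polyInHead s e) y u := by
    funext u
    rw [hΦ.map_fderiv_congr heq, hΦ.map_fderiv_add (hq.mul hwmem.1) hsmem.1,
      hΦ.map_fderiv_mul hq hwmem.1, hw]
    simp
  rw [hΦ.congr heq, map_add, map_mul, hw, mul_zero, zero_add, hsmem.2, hδ, map_add, map_smul,
    hδw, smul_zero, zero_add]

end NoetherNormalization

/-- A nonzero analytic germ is nonzero along some line through the origin. -/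
theorem AnalyticAt.exists_line_not_eventually_zero {E : Type*} [NormedAddCommGroup E]
    [NormedSpace ℝ E] {g : E → ℝ} (hg : AnalyticAt ℝ g 0) (hne : ¬ g =ᶠ[𝓝 0] 0) :
    ∃ v, ¬ ∀ᶠ t : ℝ in 𝓝 0, g (t • v) = 0 := by
  obtain ⟨ε, hε, hball⟩ := hg.exists_ball_analyticOnNhd
  by_contra! H
  refine hne ?_
  filter_upwards [Metric.ball_mem_nhds 0 hε] with v hv
  let L : ℝ →L[ℝ] E := (ContinuousLinearMap.id ℝ ℝ).smulRight v
  have hL : ∀ t, L t = t • v := fun t => rfl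
  have han : AnalyticOnNhd ℝ (g ∘ L) (L ⁻¹' Metric.ball 0 ε) := fun t ht =>
    (hball (L t) ht).comp (L.analyticAt t)
  have hpre : IsPreconnected (L ⁻¹' Metric.ball 0 ε) :=
    ((convex_ball 0 ε).linear_preimage L.toLinearMap).isPreconnected
  have := han.eqOn_zero_of_preconnected_of_eventuallyEq_zero hpre
    (by simpa using hε : (0 : ℝ) ∈ _) (H v) (by simpa [hL] using hv : (1 : ℝ) ∈ _)
  simpa [hL] using this

section NoetherNormalization

variable {K : Type*} [Field K] [Algebra ℝ K]

theorem IsChainRuleDerivation.of_equiv {E F : Type*} [NormedAddCommGroup E] [NormedSpace ℝ E]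
    [NormedAddCommGroup F] [NormedSpace ℝ F] {Φ : (E → ℝ) →ₐ[ℝ] K} {D : Derivation ℤ K K}
    (A : F ≃L[ℝ] E) (hD : IsChainRuleDerivation (Φ.comp (pullback A.symm)) D) :
    IsChainRuleDerivation Φ D := by
  obtain ⟨Λ, hΛ⟩ := hD
  refine ⟨Λ.comp (LinearMap.funLeft K K A), fun g hg => ?_⟩
  have h1 : Φ g = Φ.comp (pullback A.symm) (g ∘ A) := by
    rw [AlgHom.comp_apply]
    congr 1
    funext x
    simp
  rw [h1, hΛ _ (AnalyticAt.comp (g := g) (by rwa [map_zero])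
    (A.analyticAt 0)), LinearMap.comp_apply]
  congr 1
  funext u
  rw [AlgHom.comp_apply, LinearMap.funLeft_apply]
  congr 1
  funext y
  simp [A.comp_right_fderiv]

theorem isIntegral_analyticImage_trans {E F G : Type*} [NormedAddCommGroup E] [NormedSpace ℝ E]
    [NormedAddCommGroup F] [NormedSpace ℝ F] [NormedAddCommGroup G] [NormedSpace ℝ G]
    {Φ : (E → ℝ) →ₐ[ℝ] K} {Ψ : (F → ℝ) →ₐ[ℝ] K} {Θ : (G → ℝ) →ₐ[ℝ] K}
    (hΨ : ∀ g, AnalyticAt ℝ g 0 → IsIntegral (analyticImage Θ) (Ψ g))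
    (hΦ : ∀ g, AnalyticAt ℝ g 0 → IsIntegral (analyticImage Ψ) (Φ g)) {g : E → ℝ}
    (hg : AnalyticAt ℝ g 0) : IsIntegral (analyticImage Θ) (Φ g) := by
  let C := integralClosure (analyticImage Θ) K
  refine isIntegral_trans (A := C) _ ?_
  let ψ : analyticImage Ψ →+* C :=
    { toFun := fun x => ⟨x, by obtain ⟨h, hh, hx⟩ := x.2; rw [← hx]; exact hΨ h hh⟩
      map_one' := rfl
      map_mul' := fun _ _ => rfl
      map_zero' := rfl
      map_add' := fun _ _ => rfl }
  exact (hΦ g hg).map_of_comp_eq ψ (RingHom.id K) rfl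

/-- Noether normalization for homomorphisms from germs of analytic functions to a field. In addition
to finiteness, the chain rule for derivations is inherited from the normalization. -/
theorem exists_noether_normalization : ∀ (n : ℕ) {Φ : ((Fin n → ℝ) → ℝ) →ₐ[ℝ] K},
    FactorsThroughGerms Φ → ∃ (m : ℕ) (π : (Fin n → ℝ) →L[ℝ] (Fin m → ℝ)),
      (∀ g, AnalyticAt ℝ g 0 → Φ (pullback π g) = 0 → g =ᶠ[𝓝 0] 0) ∧
      (∀ g, AnalyticAt ℝ g 0 → IsIntegral (analyticImage (Φ.comp (pullback π))) (Φ g)) ∧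
      ∀ D, IsChainRuleDerivation (Φ.comp (pullback π)) D → IsChainRuleDerivation Φ D := by
  intro n
  induction n with
  | zero =>
    intro Φ hΦ
    refine ⟨0, .id ℝ _, fun g hg h => ?_, fun g hg =>
      isIntegral_algebraMap (x := (⟨Φ g, g, hg, rfl⟩ : analyticImage Φ)), fun D hD => hD⟩
    refine .of_forall fun x => ?_
    rw [Subsingleton.elim x 0]
    exact hΦ.apply_zero_eq_zero hg.continuousAt h
  | succ n ih =>
    intro Φ hΦ
    by_cases hinj : ∀ g, AnalyticAt ℝ g 0 → Φ g = 0 → g =ᶠ[𝓝 0] 0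
    · exact ⟨n + 1, .id ℝ _, hinj, fun g hg =>
        isIntegral_algebraMap (x := (⟨Φ g, g, hg, rfl⟩ : analyticImage Φ)), fun D hD => hD⟩
    push Not at hinj
    obtain ⟨g, hg, hΦg, hne⟩ := hinj
    obtain ⟨v, hv⟩ := hg.exists_line_not_eventually_zero hne
    have hv0 : v ≠ 0 := by
      rintro rfl
      refine hv (.of_forall fun t => ?_)
      rw [smul_zero]
      exact hΦ.apply_zero_eq_zero hg.continuousAt hΦg
    obtain ⟨A, hA⟩ := SeparatingDual.exists_continuousLinearEquiv_apply_eq (R := ℝ)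
      (x := (Pi.single 0 1 : Fin (n + 1) → ℝ)) (by simp) hv0
    have hΦA : FactorsThroughGerms (Φ.comp (pullback A.symm)) :=
      hΦ.comp_pullback A.symm.continuous.continuousAt (map_zero _)
    have hgA : AnalyticAt ℝ (g ∘ A) 0 := AnalyticAt.comp (g := g) (by rwa [map_zero])
      (A.analyticAt 0)
    have hneA : ¬ ∀ᶠ t : ℝ in 𝓝 0, (g ∘ A) (Pi.single 0 t) = 0 := by
      have : ∀ t : ℝ, (Pi.single 0 t : Fin (n + 1) → ℝ) = t • Pi.single 0 1 := fun t => by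
        rw [← Pi.single_smul, smul_eq_mul, mul_one]
      refine fun H => hv (H.mono fun t ht => ?_)
      rwa [Function.comp_apply, this, map_smul, hA] at ht
    have hΦgA : Φ.comp (pullback A.symm) (g ∘ A) = 0 := by
      rw [← hΦg, AlgHom.comp_apply]
      congr 1
      funext x
      simp
    obtain ⟨m, π, h1, h2, h3⟩ := ih (Φ := (Φ.comp (pullback A.symm)).comp (pullback (tailCLM n)))
      (hΦA.comp_pullback (tailCLM n).continuous.continuousAt (map_zero _))
    refine ⟨m, (π.comp (tailCLM n)).comp A.symm.toContinuousLinearMap, h1, ?_, fun D hD =>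
      ((h3 D hD).of_tail hΦA hgA hneA hΦgA).of_equiv A⟩
    intro h hh
    have hhA : AnalyticAt ℝ (h ∘ A) 0 := AnalyticAt.comp (g := h) (by rwa [map_zero])
      (A.analyticAt 0)
    have hΦh : Φ h = Φ.comp (pullback A.symm) (h ∘ A) := by
      rw [AlgHom.comp_apply]
      congr 1
      funext x
      simp
    rw [hΦh]
    exact isIntegral_analyticImage_trans (Φ := Φ.comp (pullback A.symm)) h2
      (fun k hk => isIntegral_analyticImage_tail hΦA hgA hneA hΦgA hk) hhA

end NoetherNormalization

theorem AnalyticAt.fderiv_apply {E : Type*} [NormedAddCommGroup E] [NormedSpace ℝ E] {g : E → ℝ}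
    {x : E} (hg : AnalyticAt ℝ g x) (u : E) : AnalyticAt ℝ (fun y => fderiv ℝ g y u) x :=
  hg.fderiv.clm_apply' analyticAt_const

/-- Two analytic germs whose quotient has vanishing derivative are proportional. -/
theorem AnalyticAt.exists_eventuallyEq_const_mul {E : Type*} [NormedAddCommGroup E]
    [NormedSpace ℝ E] {u v : E → ℝ} (hu : AnalyticAt ℝ u 0) (hv : AnalyticAt ℝ v 0)
    (hne : ¬ v =ᶠ[𝓝 0] 0)
    (h : ∀ w, ∀ᶠ y in 𝓝 0, v y * fderiv ℝ u y w = u y * fderiv ℝ v y w) :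
    ∃ c : ℝ, u =ᶠ[𝓝 0] fun y => c * v y := by
  obtain ⟨ε, hε, hball'⟩ :=
    Metric.mem_nhds_iff.1 (hu.eventually_analyticAt.and hv.eventually_analyticAt)
  have hball : ∀ x ∈ Metric.ball (0 : E) ε, AnalyticAt ℝ u x ∧ AnalyticAt ℝ v x :=
    fun x hx => hball' hx
  have hpre : IsPreconnected (Metric.ball (0 : E) ε) := (convex_ball 0 ε).isPreconnected
  have h' : ∀ w, ∀ y ∈ Metric.ball (0 : E) ε, v y * fderiv ℝ u y w = u y * fderiv ℝ v y w := by
    intro w y hy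
    have han : AnalyticOnNhd ℝ (fun y => v y * fderiv ℝ u y w - u y * fderiv ℝ v y w)
        (Metric.ball 0 ε) := fun x hx =>
      ((hball x hx).2.mul ((hball x hx).1.fderiv_apply w)).sub
        ((hball x hx).1.mul ((hball x hx).2.fderiv_apply w))
    refine sub_eq_zero.1 (han.eqOn_zero_of_preconnected_of_eventuallyEq_zero hpre
      (Metric.mem_ball_self hε) ?_ hy)
    filter_upwards [h w] with x hx
    simpa [sub_eq_zero] using hx
  obtain ⟨x₀, hx₀, hvx₀⟩ : ∃ x₀ ∈ Metric.ball (0 : E) ε, v x₀ ≠ 0 := by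
    by_contra! H
    exact hne (Filter.eventually_of_mem (Metric.ball_mem_nhds 0 hε) H)
  obtain ⟨δ, hδ, hδball⟩ := Metric.mem_nhds_iff.1 (Filter.inter_mem
    (Metric.isOpen_ball.mem_nhds hx₀) ((hball x₀ hx₀).2.continuousAt.eventually_ne hvx₀))
  have hder : ∀ x ∈ Metric.ball x₀ δ, HasFDerivAt (fun y => u y * (v y)⁻¹) (0 : E →L[ℝ] ℝ) x := by
    intro x hx
    obtain ⟨hxε, hvx⟩ := hδball hx
    have hvx : v x ≠ 0 := hvx
    have h1 := (hball x hxε).1.differentiableAt.hasFDerivAt.mul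
      ((hasDerivAt_inv hvx).comp_hasFDerivAt x (hball x hxε).2.differentiableAt.hasFDerivAt)
    refine h1.congr_fderiv ?_
    ext w
    have := h' w x hxε
    simp
    field_simp
    linarith
  obtain ⟨c, hc⟩ := Metric.isOpen_ball.exists_is_const_of_fderiv_eq_zero (𝕜 := ℝ)
    (convex_ball x₀ δ).isPreconnected
    (fun x hx => (hder x hx).differentiableAt.differentiableWithinAt)
    fun x hx => (hder x hx).fderiv
  refine ⟨c, ?_⟩
  have han : AnalyticOnNhd ℝ (fun y => u y - c * v y) (Metric.ball 0 ε) := fun x hx =>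
    (hball x hx).1.sub (analyticAt_const.mul (hball x hx).2)
  have hzero := han.eqOn_zero_of_preconnected_of_eventuallyEq_zero hpre hx₀ (by
    filter_upwards [Metric.ball_mem_nhds x₀ hδ] with x hx
    have hvx : v x ≠ 0 := (hδball hx).2
    rw [← hc x hx, inv_mul_cancel_right₀ hvx, sub_self, Pi.zero_apply])
  filter_upwards [Metric.ball_mem_nhds 0 hε] with x hx
  exact sub_eq_zero.1 (hzero hx)

section CriticalValue

variable {K : Type*} [Field K] [Algebra ℝ K]

open Polynomial in
/-- The image of a germ vanishing at the origin is zero as soon as it is algebraic over `ℝ`. -/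
theorem FactorsThroughGerms.map_eq_zero_of_isIntegral {E : Type*} [NormedAddCommGroup E]
    {Φ : (E → ℝ) →ₐ[ℝ] K} (hΦ : FactorsThroughGerms Φ) {f : E → ℝ} (hf : ContinuousAt f 0)
    (hf0 : f 0 = 0) (h : IsIntegral ℝ (Φ f)) : Φ f = 0 := by
  obtain ⟨p, hp, hpf⟩ := h
  obtain ⟨q, hpq, hq⟩ := exists_eq_pow_rootMultiplicity_mul_and_not_dvd p hp.ne_zero 0
  rw [← aeval_def, hpq, map_mul, map_pow, map_sub, aeval_X, aeval_C, map_zero, sub_zero] at hpf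
  refine eq_zero_of_pow_eq_zero ((mul_eq_zero.1 hpf).resolve_right fun h0 => ?_)
  rw [aeval_algHom_apply] at h0
  have happ : ∀ x, aeval f q x = q.eval (f x) := fun x => by
    rw [← coe_aeval_eq_eval]
    exact (aeval_algHom_apply (Pi.evalAlgHom ℝ (fun _ : E => ℝ) x) f q).symm
  have h1 := hΦ.apply_zero_eq_zero (g := aeval f q) (by
    rw [show aeval f q = fun x => q.eval (f x) from funext happ]
    exact q.continuous.continuousAt.comp hf) h0
  rw [happ, hf0] at h1
  exact hq (dvd_iff_isRoot.2 h1)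

/-- If `Ψ` is injective on analytic germs, directional derivatives extend to derivations of `K`. -/
theorem exists_chainRuleDerivation {F : Type*} [NormedAddCommGroup F] [NormedSpace ℝ F]
    {Ψ : (F → ℝ) →ₐ[ℝ] K} (hΨ : FactorsThroughGerms Ψ)
    (hinj : ∀ g, AnalyticAt ℝ g 0 → Ψ g = 0 → g =ᶠ[𝓝 0] 0) (w : F) :
    ∃ D : Derivation ℤ K K, ∀ g, AnalyticAt ℝ g 0 → D (Ψ g) = Ψ fun y => fderiv ℝ g y w := by
  have : CharZero K := charZero_of_injective_algebraMap (algebraMap ℝ K).injective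
  have hrep : ∀ r : analyticImage Ψ, ∃ g, AnalyticAt ℝ g 0 ∧ Ψ g = r := fun r =>
    mem_analyticImage.1 r.2
  choose G hG hGr using hrep
  have hwell : ∀ (r : analyticImage Ψ) (g : F → ℝ), AnalyticAt ℝ g 0 → Ψ g = r →
      Ψ (fun y => fderiv ℝ (G r) y w) = Ψ fun y => fderiv ℝ g y w := by
    intro r g hg hgr
    refine hΨ.map_fderiv_congr ?_ w
    have := hinj (G r - g) ((hG r).sub hg) (by rw [map_sub, hGr, hgr, sub_self])
    filter_upwards [this] with y hy
    exact sub_eq_zero.1 hy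
  obtain ⟨D, hD⟩ := exists_derivation_extension (R := analyticImage Ψ) (K := K)
    Subtype.val_injective (fun r => Ψ fun y => fderiv ℝ (G r) y w)
    (fun a b => by
      rw [hwell (a + b) (G a + G b) ((hG a).add (hG b)) (by rw [map_add, hGr, hGr]; rfl),
        hΨ.map_fderiv_add (hG a) (hG b)])
    (fun a b => by
      rw [hwell (a * b) (G a * G b) ((hG a).mul (hG b)) (by rw [map_mul, hGr, hGr]; rfl),
        hΨ.map_fderiv_mul (hG a) (hG b), hGr, hGr]
      rfl)
  refine ⟨D, fun g hg => ?_⟩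
  have := hD ⟨Ψ g, g, hg, rfl⟩
  rwa [hwell _ g hg rfl] at this

open Polynomial in
/-- An element annihilated by all extended directional derivatives is algebraic over `ℝ`. -/
theorem isIntegral_of_forall_derivation_eq_zero {F : Type*} [NormedAddCommGroup F]
    [NormedSpace ℝ F] {Ψ : (F → ℝ) →ₐ[ℝ] K} (hΨ : FactorsThroughGerms Ψ)
    (hinj : ∀ g, AnalyticAt ℝ g 0 → Ψ g = 0 → g =ᶠ[𝓝 0] 0) {a : K}
    (ha : IsIntegral (analyticImage Ψ) a)
    (hD : ∀ (w : F) (D : Derivation ℤ K K),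
      (∀ g, AnalyticAt ℝ g 0 → D (Ψ g) = Ψ fun y => fderiv ℝ g y w) → D a = 0) :
    IsIntegral ℝ a := by
  classical
  let R := analyticImage Ψ
  have hex : ∃ N, ∃ p : R[X], p ≠ 0 ∧ aeval a p = 0 ∧ p.natDegree = N := by
    obtain ⟨p, hp, hpa⟩ := ha
    exact ⟨_, p, hp.ne_zero, hpa, rfl⟩
  obtain ⟨p, hp0, hpa, hpN⟩ := Nat.find_spec hex
  set N := Nat.find hex
  choose P hP hPp using fun j => mem_analyticImage.1 (p.coeff j).2
  have hB : ¬ P N =ᶠ[𝓝 0] 0 := by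
    intro h
    have h1 : (p.coeff N : K) = 0 := by rw [← hPp, hΨ _ h]
    exact hp0 (leadingCoeff_eq_zero.1 (by rw [leadingCoeff, hpN]; exact Subtype.ext h1))
  have hsum : ∑ j ∈ Finset.range (N + 1), Ψ (P j) * a ^ j = 0 := by
    rw [aeval_eq_sum_range, hpN] at hpa
    simp only [hPp]
    exact hpa
  have hconst : ∀ j < N, ∃ c : ℝ, P j =ᶠ[𝓝 0] fun y => c * P N y := by
    intro j hj
    refine (hP j).exists_eventuallyEq_const_mul (hP N) hB fun w => ?_
    obtain ⟨D, hDg⟩ := exists_chainRuleDerivation hΨ hinj w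
    have hDa := hD w D hDg
    let W : ℕ → F → ℝ := fun j y => P N y * fderiv ℝ (P j) y w - P j y * fderiv ℝ (P N) y w
    have hW : ∀ j, AnalyticAt ℝ (W j) 0 := fun j =>
      ((hP N).mul ((hP j).fderiv_apply w)).sub ((hP j).mul ((hP N).fderiv_apply w))
    have hΨW : ∀ j, Ψ (W j) = Ψ (P N) * D (Ψ (P j)) - D (Ψ (P N)) * Ψ (P j) := by
      intro j
      rw [hDg _ (hP j), hDg _ (hP N), mul_comm (Ψ _) (Ψ (P j)), ← map_mul, ← map_mul, ← map_sub]
      rfl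
    let q : R[X] := ∑ j ∈ Finset.range N, C ⟨Ψ (W j), W j, hW j, rfl⟩ * X ^ j
    have hqdeg : q ∈ degreeLT R N := sum_mem fun j hj => mem_degreeLT.2 <|
      (degree_C_mul_X_pow_le _ _).trans_lt (by exact_mod_cast Finset.mem_range.1 hj)
    have hqa : aeval a q = 0 := by
      have h1 : aeval a q = ∑ j ∈ Finset.range N, Ψ (W j) * a ^ j := by
        simp only [q, map_sum, map_mul, map_pow, aeval_X, aeval_C]
        rfl
      have h2 : Ψ (W N) * a ^ N = 0 := by
        rw [hΨW, mul_comm (D _), sub_self, zero_mul]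
      have h3 : ∑ j ∈ Finset.range (N + 1), D (Ψ (P j)) * a ^ j = 0 := by
        have := congrArg D hsum
        rw [map_sum, map_zero] at this
        rw [← this]
        refine Finset.sum_congr rfl fun j _ => ?_
        rw [D.leibniz, D.leibniz_pow, hDa]
        simp [mul_comm]
      have h4 := Finset.sum_range_succ (fun j => Ψ (W j) * a ^ j) N
      rw [h2, add_zero] at h4
      rw [h1, ← h4]
      simp only [hΨW, sub_mul, Finset.sum_sub_distrib, mul_assoc, ← Finset.mul_sum, h3, hsum,
        mul_zero, sub_zero]
    have hq0 : q = 0 := by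
      by_contra hq0
      refine Nat.find_min hex ((natDegree_lt_iff_degree_lt hq0).2 (mem_degreeLT.1 hqdeg))
        ⟨q, hq0, hqa, rfl⟩
    have hcoeff : Ψ (W j) = 0 := by
      have := congrArg (fun r : R[X] => (r.coeff j : K)) hq0
      simpa [q, finsetSum_coeff, coeff_C_mul, coeff_X_pow, hj] using this
    filter_upwards [hinj _ (hW j) hcoeff] with y hy
    exact sub_eq_zero.1 hy
  choose! c hc using hconst
  refine ⟨X ^ N - ∑ j ∈ Finset.range N, C (-c j) * X ^ j, monic_X_pow_sub_sum _ N, ?_⟩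
  have hb : Ψ (P N) ≠ 0 := fun h => hB (hinj _ (hP N) h)
  refine (mul_eq_zero.1 (?_ : Ψ (P N) * _ = 0)).resolve_left hb
  rw [← hsum, Finset.sum_range_succ, ← aeval_def]
  simp only [map_sub, map_sum, map_mul, map_pow, aeval_X, aeval_C, map_neg]
  rw [mul_sub, Finset.mul_sum, sub_eq_neg_add, ← Finset.sum_neg_distrib]
  congr 1
  refine Finset.sum_congr rfl fun j hj => ?_
  have : Ψ (P j) = algebraMap ℝ K (c j) * Ψ (P N) := by
    rw [hΨ.congr (hc j (Finset.mem_range.1 hj)), ← Ψ.commutes, ← map_mul]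
    rfl
  rw [this]
  ring

/-- A homomorphism to a field killing all derivatives of an analytic germ that vanishes at the
origin kills the germ itself. -/
theorem FactorsThroughGerms.map_eq_zero_of_map_fderiv_eq_zero {n : ℕ}
    {Φ : ((Fin n → ℝ) → ℝ) →ₐ[ℝ] K} (hΦ : FactorsThroughGerms Φ) {f : (Fin n → ℝ) → ℝ}
    (hf : AnalyticAt ℝ f 0) (hf0 : f 0 = 0) (h : ∀ u, Φ (fun y => fderiv ℝ f y u) = 0) :
    Φ f = 0 := by
  obtain ⟨m, π, hinj, hint, hder⟩ := exists_noether_normalization n hΦ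
  have hΨ : FactorsThroughGerms (Φ.comp (pullback π)) :=
    hΦ.comp_pullback π.continuous.continuousAt (map_zero π)
  refine hΦ.map_eq_zero_of_isIntegral hf.continuousAt hf0
    (isIntegral_of_forall_derivation_eq_zero hΨ hinj (hint f hf) fun w D hD => ?_)
  obtain ⟨Λ, hΛ⟩ := hder D ⟨LinearMap.proj w, hD⟩
  rw [hΛ f hf, ← map_zero Λ]
  congr 1
  funext u
  exact h u

/-- Near a zero of an analytic function, all critical points are zeros. -/
theorem eventually_eq_zero_of_fderiv_eq_zero {n : ℕ} {f : (Fin n → ℝ) → ℝ}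
    (hf : AnalyticAt ℝ f 0) (hf0 : f 0 = 0) :
    ∀ᶠ x in 𝓝 0, fderiv ℝ f x = 0 → f x = 0 := by
  by_contra H
  let l : Filter (Fin n → ℝ) := 𝓝 0 ⊓ 𝓟 {x | fderiv ℝ f x = 0 ∧ f x ≠ 0}
  have hl : l.NeBot := by
    rw [not_eventually] at H
    exact frequently_mem_iff_neBot.1 (H.mono fun x hx => Classical.not_imp.1 hx)
  let I : Ideal ((Fin n → ℝ) → ℝ) :=
    { carrier := {g | ∀ᶠ x in l, g x = 0}
      add_mem' := fun {a b} ha hb => by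
        change ∀ᶠ x in l, a x + b x = 0
        filter_upwards [ha, hb] with x h1 h2
        simp [h1, h2]
      zero_mem' := Eventually.of_forall (f := l) fun _ => rfl
      smul_mem' := fun c g hg => by
        change ∀ᶠ x in l, c x * g x = 0
        filter_upwards [hg] with x h1
        simp [h1] }
  have hmemI : ∀ {g}, g ∈ I ↔ ∀ᶠ x in l, g x = 0 := Iff.rfl
  have hI : I ≠ ⊤ := by
    rw [Ideal.ne_top_iff_one, hmemI]
    simpa using hl.ne
  obtain ⟨M, hM, hIM⟩ := I.exists_le_maximal hI
  let := Ideal.Quotient.field M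
  let Φ := Ideal.Quotient.mkₐ ℝ M
  have hΦI : ∀ {g}, g ∈ I → Φ g = 0 := fun hg => Ideal.Quotient.eq_zero_iff_mem.2 (hIM hg)
  have hΦ : FactorsThroughGerms Φ := fun g hg => hΦI (hg.filter_mono inf_le_left)
  have hcrit : ∀ᶠ x in l, fderiv ℝ f x = 0 ∧ f x ≠ 0 :=
    mem_inf_of_right (mem_principal_self _)
  have hΦf : Φ f = 0 := hΦ.map_eq_zero_of_map_fderiv_eq_zero hf hf0 fun u => hΦI <| by
    filter_upwards [hcrit] with x hx
    simp [hx.1]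
  have h1 : Φ (1 - f * f⁻¹) = 0 := hΦI <| by
    filter_upwards [hcrit] with x hx
    simp [hx.2]
  rw [map_sub, map_mul, hΦf, zero_mul, sub_zero, map_one] at h1
  exact one_ne_zero h1

end CriticalValue

/-- An analytic function is locally constant on its critical set. -/
theorem EuclideanSpace.eventually_eq_of_fderiv_eq_zero {n : ℕ} {f : EuclideanSpace ℝ (Fin n) → ℝ}
    {x₀ : EuclideanSpace ℝ (Fin n)} (hf : AnalyticAt ℝ f x₀) :
    ∀ᶠ x in 𝓝 x₀, fderiv ℝ f x = 0 → f x = f x₀ := by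
  let L := EuclideanSpace.equiv (Fin n) ℝ
  let g : (Fin n → ℝ) → ℝ := fun y => f (x₀ + L.symm y) - f x₀
  have hg : AnalyticAt ℝ g 0 := by
    have h1 : AnalyticAt ℝ (fun y => x₀ + L.symm y) 0 := analyticAt_const.add (L.symm.analyticAt 0)
    exact (AnalyticAt.comp (g := f) (by simpa using hf) h1).sub analyticAt_const
  have hL : Tendsto (fun x => L (x - x₀)) (𝓝 x₀) (𝓝 0) :=
    (L.continuous.comp (continuous_id.sub continuous_const)).tendsto' _ _ (by simp)
  filter_upwards [hL.eventually (eventually_eq_zero_of_fderiv_eq_zero hg (by simp [g])),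
    hf.eventually_analyticAt] with x hx hfx hcrit
  have hxy : x₀ + L.symm (L (x - x₀)) = x := by simp
  have hder : HasFDerivAt g (0 : (Fin n → ℝ) →L[ℝ] ℝ) (L (x - x₀)) := by
    have h1 : HasFDerivAt f (0 : EuclideanSpace ℝ (Fin n) →L[ℝ] ℝ) (x₀ + L.symm (L (x - x₀))) := by
      rw [hxy, ← hcrit]
      exact hfx.differentiableAt.hasFDerivAt
    exact ((h1.comp (L (x - x₀)) (L.symm.hasFDerivAt.const_add x₀)).sub_const (f x₀)).congr_fderiv
      (ContinuousLinearMap.zero_comp _)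
  have := hx hder.fderiv
  simp only [g, hxy] at this
  linarith

/-- The critical values of a proper function do not accumulate if the function is locally constant
on its critical set. -/
theorem not_accPt_criticalValues {E : Type*} [NormedAddCommGroup E] [NormedSpace ℝ E] {f : E → ℝ}
    (hf : Continuous f) (hloc : ∀ x₀, ∀ᶠ x in 𝓝 x₀, fderiv ℝ f x = 0 → f x = f x₀)
    (hproper : ∀ K : Set ℝ, IsCompact K → IsCompact (f ⁻¹' K)) (c : ℝ) :
    ¬ AccPt c (𝓟 {c : ℝ | ∃ x, f x = c ∧ fderiv ℝ f x = 0}) := by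
  intro hacc
  set C : Set ℝ := {c : ℝ | ∃ x, f x = c ∧ fderiv ℝ f x = 0}
  have hne : (𝓝[≠] c ⊓ 𝓟 C).NeBot := hacc
  let l : Filter E := comap f (𝓝[≠] c ⊓ 𝓟 C) ⊓ 𝓟 {x | fderiv ℝ f x = 0}
  have hl : l.NeBot := by
    refine comap_inf_principal_neBot_of_image_mem hne (mem_inf_of_right ?_)
    rintro _ ⟨x, rfl, hx⟩
    exact ⟨x, hx, rfl⟩
  have hfl : Tendsto f l (𝓝[≠] c) := tendsto_comap.mono_left inf_le_left |>.mono_right inf_le_left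
  have hcrit : ∀ᶠ x in l, fderiv ℝ f x = 0 := mem_inf_of_right (mem_principal_self _)
  have hK : l ≤ 𝓟 (f ⁻¹' Metric.closedBall c 1) :=
    le_principal_iff.2 ((hfl.mono_right nhdsWithin_le_nhds).eventually
      (Metric.closedBall_mem_nhds c one_pos))
  obtain ⟨x, -, hx⟩ := hproper _ (isCompact_closedBall c 1) hK
  have hx : (𝓝 x ⊓ l).NeBot := hx
  have hfx : f x = c := tendsto_nhds_unique ((hf.tendsto x).mono_left inf_le_left)
    ((hfl.mono_right nhdsWithin_le_nhds).mono_left inf_le_right)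
  have hfalse : ∀ᶠ y in 𝓝 x ⊓ l, False := by
    filter_upwards [(hloc x).filter_mono inf_le_left, hcrit.filter_mono inf_le_right,
      (hfl.eventually self_mem_nhdsWithin).filter_mono inf_le_right] with y h1 h2 h3
    exact h3 ((h1 h2).trans hfx)
  exact hx.ne (by simpa using hfalse)

/-- if `f : ℝⁿ → ℝ` (`n ≥ 1`) is real-analytic and proper, then its set of
critical values is closed and discrete; in particular it has no accumulation point in `ℝ`. -/
theorem critical_values_discrete_of_analytic_proper
    (n : ℕ) (hn : 1 ≤ n)
    (f : EuclideanSpace ℝ (Fin n) → ℝ)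
    (hf : ∀ x, AnalyticAt ℝ f x)
    (hproper : ∀ K : Set ℝ, IsCompact K → IsCompact (f ⁻¹' K)) :
    IsClosed {c : ℝ | ∃ x, f x = c ∧ fderiv ℝ f x = 0} ∧
    DiscreteTopology {c : ℝ | ∃ x, f x = c ∧ fderiv ℝ f x = 0} ∧
    ∀ c : ℝ, ¬ AccPt c (Filter.principal {c : ℝ | ∃ x, f x = c ∧ fderiv ℝ f x = 0}) := by
  have hacc := not_accPt_criticalValues
    (continuous_iff_continuousAt.2 fun x => (hf x).continuousAt)
    (fun x => EuclideanSpace.eventually_eq_of_fderiv_eq_zero (hf x)) hproper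
  refine ⟨isClosed_iff_derivedSet_subset _ |>.2 fun c hc => (hacc c hc).elim,
    discreteTopology_subtype_iff.2 fun c _ => not_neBot.1 (hacc c), hacc⟩
end
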